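/- The problem of deciding, given a non-deterministic Turing machine M and a state q_r of M, whether M is non-recurring through q_r on the empty word ε (i.e., every run of M on ε features q_r only finitely many times) is Π¹₁-complete. -/

import Mathlib

/-!
Common formalization framework for "Restricted Chase Termination: You Want More than Fairness"
(Carral, Gerlach, Larroque, Thomazo).

Syntax is encoded over natural numbers so that all finite objects (rules, databases, knowledge
bases, Turing machines) live in `Primcodable` types, which allows us to speak about
many-one reductions and about the arithmetical/analytical hierarchy.
-/

namespace ChaseTermination

/-! ### Terms, atoms, facts, rules, knowledge bases -/

/-- Ground terms: `Sum.inl c` is the constant `c`, `Sum.inr n` is the null `n`. -/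
abbrev GroundTerm : Type := ℕ ⊕ ℕ

/-- Terms of rules: `Sum.inl v` is the variable `v`, `Sum.inr g` a ground term. -/
abbrev RTerm : Type := ℕ ⊕ GroundTerm

/-- A fact: a predicate (coded by a natural number) applied to ground terms. -/
abbrev Fact : Type := ℕ × List GroundTerm

/-- An atom: a predicate applied to terms. -/
abbrev Atom : Type := ℕ × List RTerm

/-- An existential rule, given by its body and its head (lists of atoms);
the universally quantified variables are those occurring in the body, the existentially
quantified ones are the head variables not occurring in the body. -/
abbrev Rule : Type := List Atom × List Atom

abbrev RuleSet : Type := List Rule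

abbrev Database : Type := List Fact

/-- A knowledge base: a (finite) rule set together with a database. -/
abbrev KB : Type := RuleSet × Database

def atomHasVar (a : Atom) (v : ℕ) : Prop := (Sum.inl v : RTerm) ∈ a.2

def atomNullFree (a : Atom) : Prop := ∀ t ∈ a.2, ∀ n : ℕ, t ≠ Sum.inr (Sum.inr n)

def factNullFree (f : Fact) : Prop := ∀ t ∈ f.2, ∀ n : ℕ, t ≠ Sum.inr n

/-- A database is a finite fact set without nulls. -/
def IsDatabase (D : Database) : Prop := ∀ f ∈ D, factNullFree f

/-- Well-formed rule: non-empty head, no nulls. -/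
def IsRule (r : Rule) : Prop := r.2 ≠ [] ∧ ∀ a ∈ r.1 ++ r.2, atomNullFree a

def IsRuleSet (S : RuleSet) : Prop := ∀ r ∈ S, IsRule r

def IsKB (kb : KB) : Prop := IsRuleSet kb.1 ∧ IsDatabase kb.2

/-- `v` occurs in the body of `r` (i.e. is universally quantified). -/
def bodyVar (r : Rule) (v : ℕ) : Prop := ∃ a ∈ r.1, atomHasVar a v

/-- `v` is an existential variable of `r`. -/
def existVar (r : Rule) (v : ℕ) : Prop := (∃ a ∈ r.2, atomHasVar a v) ∧ ¬ bodyVar r v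

def applyT (σ : ℕ → GroundTerm) : RTerm → GroundTerm
  | Sum.inl v => σ v
  | Sum.inr g => g

def applyA (σ : ℕ → GroundTerm) (a : Atom) : Fact := (a.1, a.2.map (applyT σ))

/-- A trigger: a rule together with a substitution for its (universal) variables. -/
abbrev Trigger : Type := Rule × (ℕ → GroundTerm)

/-- The support of a trigger: the instantiated body. -/
def support (t : Trigger) : Set Fact := {f | ∃ a ∈ t.1.1, f = applyA t.2 a}

/-- A trigger is loaded for `F` if `F` includes its support. -/
def loaded (t : Trigger) (F : Set Fact) : Prop := ∀ a ∈ t.1.1, applyA t.2 a ∈ F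

/-- `σ'` agrees with the substitution of `t` on all universally quantified (body) variables. -/
def agreesOnBody (t : Trigger) (σ' : ℕ → GroundTerm) : Prop :=
  ∀ v, bodyVar t.1 v → σ' v = t.2 v

/-- A trigger is obsolete for `F` if some extension of its substitution to the existential
variables sends the head into `F`. -/
def obsolete (t : Trigger) (F : Set Fact) : Prop :=
  ∃ σ' : ℕ → GroundTerm, agreesOnBody t σ' ∧ ∀ a ∈ t.1.2, applyA σ' a ∈ F

/-- The (ground) terms occurring in a fact set. -/
def termsOf (F : Set Fact) : Set GroundTerm := {g | ∃ f ∈ F, g ∈ f.2}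

/-- `σ'` is a proper output extension of the trigger `t` w.r.t. `F`: it agrees with the trigger
substitution on body variables and maps existential variables to pairwise distinct fresh nulls. -/
def properExt (t : Trigger) (F : Set Fact) (σ' : ℕ → GroundTerm) : Prop :=
  agreesOnBody t σ' ∧
  (∀ v, existVar t.1 v → ∃ n : ℕ, σ' v = Sum.inr n ∧ (Sum.inr n : GroundTerm) ∉ termsOf F) ∧
  (∀ v w, existVar t.1 v → existVar t.1 w → σ' v = σ' w → v = w)

/-- The output of a trigger under an extended substitution. -/
def outputOf (t : Trigger) (σ' : ℕ → GroundTerm) : Set Fact := {f | ∃ a ∈ t.1.2, f = applyA σ' a}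

/-- An active trigger of `S` for `F`: loaded and not obsolete. -/
def Active (S : RuleSet) (F : Set Fact) (t : Trigger) : Prop :=
  t.1 ∈ S ∧ loaded t F ∧ ¬ obsolete t F

/-- One restricted chase step. -/
def ChaseStep (S : RuleSet) (F F' : Set Fact) : Prop :=
  ∃ t : Trigger, Active S F t ∧ ∃ σ', properExt t F σ' ∧ F' = F ∪ outputOf t σ'

def dbSet (D : Database) : Set Fact := {f | f ∈ D}

/-- A (possibly infinite) restricted chase derivation for `⟨S, D⟩`, of length `len ∈ ℕ∞`.
Beyond the length the fact sets stall, so that the result is always `⋃ i, fact i`. -/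
structure Chase (S : RuleSet) (D : Set Fact) where
  len : ℕ∞
  fact : ℕ → Set Fact
  trig : ℕ → Trigger
  ext : ℕ → ℕ → GroundTerm
  init : fact 0 = D
  activeAt : ∀ i : ℕ, (i : ℕ∞) < len → Active S (fact i) (trig i)
  extOk : ∀ i : ℕ, (i : ℕ∞) < len → properExt (trig i) (fact i) (ext i)
  succ : ∀ i : ℕ, (i : ℕ∞) < len → fact (i + 1) = fact i ∪ outputOf (trig i) (ext i)
  stall : ∀ i : ℕ, ¬ ((i : ℕ∞) < len) → fact (i + 1) = fact i

/-- Fairness: every trigger that becomes loaded is eventually obsolete.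
A fair chase derivation is a *restricted chase sequence*; note that for a finite derivation
fairness forces maximality (no active trigger remains at the end). -/
def Fair {S : RuleSet} {D : Set Fact} (c : Chase S D) : Prop :=
  ∀ t : Trigger, t.1 ∈ S → ∀ i : ℕ, loaded t (c.fact i) → ∃ j : ℕ, i ≤ j ∧ obsolete t (c.fact j)

/-- The result of a chase derivation. -/
def chaseResult {S : RuleSet} {D : Set Fact} (c : Chase S D) : Set Fact := ⋃ i, c.fact i

/-- The derivation is infinite (non-terminating). -/
def IsInfinite {S : RuleSet} {D : Set Fact} (c : Chase S D) : Prop := c.len = ⊤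

/-- `TKR∀`: knowledge bases all of whose restricted chase sequences are finite. -/
def TKRall (kb : KB) : Prop :=
  IsKB kb ∧ ¬ ∃ c : Chase kb.1 (dbSet kb.2), IsInfinite c ∧ Fair c

/-- `TRR∀`: rule sets universally terminating for the restricted chase on every database. -/
def TRRall (S : RuleSet) : Prop :=
  IsRuleSet S ∧ ∀ D : Database, IsDatabase D → ¬ ∃ c : Chase S (dbSet D), IsInfinite c ∧ Fair c

/-! ### Breadth-first chase -/

/-- The instance of a trigger: its rule together with its instantiated body (this determines the
substitution on all body variables). -/
def instOf (t : Trigger) : Rule × List Fact := (t.1, t.1.1.map (applyA t.2))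

/-- The set of instances of active triggers (this is what "the number of triggers that are loaded
and not obsolete" counts). -/
def activeInsts (S : RuleSet) (F : Set Fact) : Set (Rule × List Fact) :=
  {p | ∃ t : Trigger, Active S F t ∧ p = instOf t}

/-- The breadth-first condition (†): a trigger loaded at step `i` becomes obsolete within the
next `n` steps, where `n` is the number of active triggers at step `i`. -/
def BreadthFirst {S : RuleSet} {D : Set Fact} (c : Chase S D) : Prop :=
  ∀ i : ℕ, ∀ t : Trigger, t.1 ∈ S → loaded t (c.fact i) →
    ∃ j : ℕ, i ≤ j ∧ j ≤ i + (activeInsts S (c.fact i)).ncard ∧ obsolete t (c.fact j)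

/-- `TKRBF∀`: knowledge bases all of whose breadth-first chase sequences are finite. -/
def TKRBFall (kb : KB) : Prop :=
  IsKB kb ∧ ¬ ∃ c : Chase kb.1 (dbSet kb.2), IsInfinite c ∧ BreadthFirst c

/-- `TRRBF∀`: rule sets whose breadth-first chase terminates on every database. -/
def TRRBFall (S : RuleSet) : Prop :=
  IsRuleSet S ∧ ∀ D : Database, IsDatabase D →
    ¬ ∃ c : Chase S (dbSet D), IsInfinite c ∧ BreadthFirst c

/-! ### Classes of the arithmetical and analytical hierarchies -/

/-- `Π⁰₂` predicates, via the Kleene normal form `∀ m ∃ k. R`. -/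
def Pi02 {α : Type} [Primcodable α] (p : α → Prop) : Prop :=
  ∃ R : α × ℕ → ℕ → Bool, Computable₂ R ∧ ∀ a, p a ↔ ∀ m : ℕ, ∃ k : ℕ, R (a, m) k = true

/-- `Π¹₁` predicates, via the Kleene normal form: `p a` iff for every function `f : ℕ → ℕ` some
finite initial segment of `f` witnesses a computable predicate. -/
def Pi11 {α : Type} [Primcodable α] (p : α → Prop) : Prop :=
  ∃ R : α → List ℕ → Bool, Computable₂ R ∧
    ∀ a, p a ↔ ∀ f : ℕ → ℕ, ∃ k : ℕ, R a ((List.range k).map f) = true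

/-- `Π¹₁`-hardness: every `Π¹₁` problem many-one reduces to `p`. -/
def Pi11Hard {α : Type} [Primcodable α] (p : α → Prop) : Prop :=
  ∀ q : ℕ → Prop, Pi11 q → q ≤₀ p

def Pi11Complete {α : Type} [Primcodable α] (p : α → Prop) : Prop := Pi11 p ∧ Pi11Hard p

/-! ### Non-deterministic Turing machines -/

/-- A non-deterministic Turing machine `(numStates, alphaSize, table)`.
States are `0, …, numStates - 1` with initial state `0`; tape symbols `0, …, alphaSize - 1`
form `Γ` (so `{0,1} ⊆ Γ` iff `2 ≤ alphaSize`), and the blank `B` is coded by `alphaSize`.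
An entry `((q, a), (q', b, d))` means `(q', b, d) ∈ δ(q, a)`, with `d = true` for a right move
and `d = false` for a left move. -/
abbrev NTM : Type := ℕ × ℕ × List ((ℕ × ℕ) × (ℕ × ℕ × Bool))

def NTM.numStates (M : NTM) : ℕ := M.1
def NTM.blank (M : NTM) : ℕ := M.2.1
def NTM.table (M : NTM) : List ((ℕ × ℕ) × (ℕ × ℕ × Bool)) := M.2.2

/-- Well-formedness: `Γ ⊇ {0,1}`, transitions use valid states and symbols, and the machine
never writes the blank. -/
def NTM.WF (M : NTM) : Prop :=
  1 ≤ NTM.numStates M ∧ 2 ≤ NTM.blank M ∧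
    ∀ e ∈ NTM.table M, e.1.1 < NTM.numStates M ∧ e.1.2 ≤ NTM.blank M ∧
      e.2.1 < NTM.numStates M ∧ e.2.2.1 < NTM.blank M

/-- A configuration `(tape, p, q)`: tape contents (a list of symbol codes whose last cell is
blank and in which no proper symbol occurs after a blank), 0-based head position `p`,
and current state `q`. -/
abbrev Config : Type := List ℕ × ℕ × ℕ

def WFConfig (M : NTM) (ρ : Config) : Prop :=
  ρ.2.1 < ρ.1.length ∧ ρ.1.getLast? = some (NTM.blank M) ∧
    (∀ i j : ℕ, i ≤ j → j < ρ.1.length → ρ.1.getD i 0 = NTM.blank M →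
      ρ.1.getD j 0 = NTM.blank M) ∧
    (∀ a ∈ ρ.1, a ≤ NTM.blank M) ∧ ρ.2.2 < NTM.numStates M

/-- The one-step relation `Next_M` between configurations; each step extends the represented
part of the tape by one blank cell. -/
def NTM.Next (M : NTM) (ρ ρ' : Config) : Prop :=
  ∃ q' b : ℕ, ∃ d : Bool,
    ((ρ.2.2, ρ.1.getD ρ.2.1 0), (q', b, d)) ∈ NTM.table M ∧
    (d = true ∨ 1 ≤ ρ.2.1) ∧
    ρ' = (ρ.1.set ρ.2.1 b ++ [NTM.blank M], if d then ρ.2.1 + 1 else ρ.2.1 - 1, q')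

/-- The starting configuration of `M` on a word. -/
def startConfig (M : NTM) (w : List ℕ) : Config := (w ++ [NTM.blank M], 0, 0)

/-- Words are over the input alphabet `{0, 1}`. -/
def IsWord (w : List ℕ) : Prop := ∀ a ∈ w, a < 2

/-- There is a run of `M` starting in `ρ` that visits the state `qr` infinitely often.
(Such a run is necessarily infinite, and every infinite sequence of `Next_M`-successive
configurations is a run; finite runs trivially feature `qr` only finitely many times.) -/
def RecurringFrom (M : NTM) (qr : ℕ) (ρ : Config) : Prop :=
  ∃ c : ℕ → Config, c 0 = ρ ∧ (∀ i, NTM.Next M (c i) (c (i + 1))) ∧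
    ∀ N : ℕ, ∃ i : ℕ, N ≤ i ∧ (c i).2.2 = qr

/-- `M` is non-recurring through `qr` on the configuration `ρ`: every run of `M` on `ρ`
features `qr` only finitely many times. -/
def NonRecurringFrom (M : NTM) (qr : ℕ) (ρ : Config) : Prop := ¬ RecurringFrom M qr ρ

end ChaseTermination
namespace ChaseTermination

/-! ### The rule set `Σ_M` of Section 4 and the databases `D_ρ` -/

/-- Predicate codes. `pF`, `pR` are the ternary time/tape successor predicates. -/
def pF : ℕ := 0
def pR : ℕ := 1
def pCL : ℕ := 2
def pCR : ℕ := 3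
def pReal : ℕ := 4
def pBrake : ℕ := 5
def pNextBr : ℕ := 6
def pEnd : ℕ := 7
/-- The binary letter predicate for the tape symbol `a`. -/
def pLetter (a : ℕ) : ℕ := 8 + 2 * a
/-- The binary state predicate for the state `q`. -/
def pState (q : ℕ) : ℕ := 9 + 2 * q

/-- Variable codes used in the rules: `x, y, x', y', w, w'` are `0, …, 5`. -/
def tv (v : ℕ) : RTerm := Sum.inl v

def A1 (p : ℕ) (s : RTerm) : Atom := (p, [s])
def A2 (p : ℕ) (s t : RTerm) : Atom := (p, [s, t])
def A3 (p : ℕ) (s t u : RTerm) : Atom := (p, [s, t, u])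

/-- `brSet(x, w)` as atoms: `{F(x,w,w), R(x,w,w), Real(x), Brake(w)}`. -/
def brSetA (x w : RTerm) : List Atom := [A3 pF x w w, A3 pR x w w, A1 pReal x, A1 pBrake w]

/-- Tape alphabet including the blank: `Γ ∪ {B}`. -/
def letters (M : NTM) : List ℕ := List.range (NTM.blank M + 1)
def states (M : NTM) : List ℕ := List.range (NTM.numStates M)

/-- The rule `R_Brake`. -/
def ruleBrake (M : NTM) : Rule :=
  ([A1 pBrake (tv 4)],
    ((letters M).map fun a => A2 (pLetter a) (tv 4) (tv 4)) ++
    ((states M).map fun q => A2 (pState q) (tv 4) (tv 4)) ++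
    [A3 pF (tv 4) (tv 4) (tv 4), A3 pR (tv 4) (tv 4) (tv 4),
     A2 pCL (tv 4) (tv 4), A2 pCR (tv 4) (tv 4), A1 pReal (tv 4), A2 pNextBr (tv 4) (tv 4)])

/-- The rule `R_nextBr`. -/
def ruleNextBr : Rule :=
  (brSetA (tv 0) (tv 4) ++ [A2 pNextBr (tv 4) (tv 5)], brSetA (tv 0) (tv 5))

/-- Transition rule for `(q', b, →) ∈ δ(q, a)` and the letter `c`; if `q = qr` a fresh
brake `w'` is created together with a `nextBr`-atom, otherwise the brake `w` is reused. -/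
def mkTransRight (qr q a q' b c : ℕ) : Rule :=
  ([A2 (pState q) (tv 0) (tv 4), A2 (pLetter a) (tv 0) (tv 4), A3 pR (tv 0) (tv 1) (tv 4),
    A2 (pLetter c) (tv 1) (tv 4)] ++ brSetA (tv 0) (tv 4) ++ brSetA (tv 1) (tv 4),
   if q = qr then
     [A2 (pState q') (tv 3) (tv 5), A2 (pLetter c) (tv 3) (tv 5), A2 (pLetter b) (tv 2) (tv 5),
      A3 pR (tv 2) (tv 3) (tv 5), A3 pF (tv 0) (tv 2) (tv 5), A3 pF (tv 1) (tv 3) (tv 5),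
      A2 pCL (tv 2) (tv 5), A2 pCR (tv 3) (tv 5)] ++
      brSetA (tv 2) (tv 5) ++ brSetA (tv 3) (tv 5) ++ [A2 pNextBr (tv 4) (tv 5)]
   else
     [A2 (pState q') (tv 3) (tv 4), A2 (pLetter c) (tv 3) (tv 4), A2 (pLetter b) (tv 2) (tv 4),
      A3 pR (tv 2) (tv 3) (tv 4), A3 pF (tv 0) (tv 2) (tv 4), A3 pF (tv 1) (tv 3) (tv 4),
      A2 pCL (tv 2) (tv 4), A2 pCR (tv 3) (tv 4)] ++ brSetA (tv 2) (tv 4) ++ brSetA (tv 3) (tv 4))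

/-- Transition rule for `(q', b, ←) ∈ δ(q, a)` and the letter `c`. -/
def mkTransLeft (qr q a q' b c : ℕ) : Rule :=
  ([A2 (pState q) (tv 0) (tv 4), A2 (pLetter a) (tv 0) (tv 4), A3 pR (tv 1) (tv 0) (tv 4),
    A2 (pLetter c) (tv 1) (tv 4)] ++ brSetA (tv 0) (tv 4) ++ brSetA (tv 1) (tv 4),
   if q = qr then
     [A2 (pState q') (tv 3) (tv 5), A2 (pLetter c) (tv 3) (tv 5), A2 (pLetter b) (tv 2) (tv 5),
      A3 pR (tv 3) (tv 2) (tv 5), A3 pF (tv 0) (tv 2) (tv 5), A3 pF (tv 1) (tv 3) (tv 5),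
      A2 pCL (tv 3) (tv 5), A2 pCR (tv 2) (tv 5)] ++
      brSetA (tv 2) (tv 5) ++ brSetA (tv 3) (tv 5) ++ [A2 pNextBr (tv 4) (tv 5)]
   else
     [A2 (pState q') (tv 3) (tv 4), A2 (pLetter c) (tv 3) (tv 4), A2 (pLetter b) (tv 2) (tv 4),
      A3 pR (tv 3) (tv 2) (tv 4), A3 pF (tv 0) (tv 2) (tv 4), A3 pF (tv 1) (tv 3) (tv 4),
      A2 pCL (tv 3) (tv 4), A2 pCR (tv 2) (tv 4)] ++ brSetA (tv 2) (tv 4) ++ brSetA (tv 3) (tv 4))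

/-- All transition rules of `Σ_M` (one per table entry and letter `c`). -/
def transRules (M : NTM) (qr : ℕ) : List Rule :=
  (NTM.table M).foldr (fun e acc =>
    ((letters M).map fun cc =>
      if e.2.2.2 = true then mkTransRight qr e.1.1 e.1.2 e.2.1 e.2.2.1 cc
      else mkTransLeft qr e.1.1 e.1.2 e.2.1 e.2.2.1 cc) ++ acc) []

/-- The rule `R_{C_R}` for the letter `a`. -/
def mkCopyRight (a : ℕ) : Rule :=
  ([A2 pCR (tv 2) (tv 5), A3 pF (tv 0) (tv 2) (tv 5), A3 pR (tv 0) (tv 1) (tv 4),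
    A2 (pLetter a) (tv 1) (tv 4)] ++
    brSetA (tv 0) (tv 4) ++ brSetA (tv 2) (tv 5) ++ brSetA (tv 1) (tv 4),
   [A3 pF (tv 1) (tv 3) (tv 5), A3 pR (tv 2) (tv 3) (tv 5), A2 (pLetter a) (tv 3) (tv 5),
    A2 pCR (tv 3) (tv 5)] ++ brSetA (tv 3) (tv 5))

/-- The rule `R_{C_L}` for the letter `a`. -/
def mkCopyLeft (a : ℕ) : Rule :=
  ([A2 pCL (tv 2) (tv 5), A3 pF (tv 0) (tv 2) (tv 5), A3 pR (tv 1) (tv 0) (tv 4),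
    A2 (pLetter a) (tv 1) (tv 4)] ++
    brSetA (tv 0) (tv 4) ++ brSetA (tv 2) (tv 5) ++ brSetA (tv 1) (tv 4),
   [A3 pF (tv 1) (tv 3) (tv 5), A3 pR (tv 3) (tv 2) (tv 5), A2 (pLetter a) (tv 3) (tv 5),
    A2 pCL (tv 3) (tv 5)] ++ brSetA (tv 3) (tv 5))

def copyRightRules (M : NTM) : List Rule := (letters M).map mkCopyRight
def copyLeftRules (M : NTM) : List Rule := (letters M).map mkCopyLeft

/-- The tape-extension rule `R_End`. -/
def ruleEnd (M : NTM) : Rule :=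
  ([A2 pCR (tv 2) (tv 5), A3 pF (tv 0) (tv 2) (tv 5), A2 pEnd (tv 0) (tv 4)] ++
    brSetA (tv 0) (tv 4) ++ brSetA (tv 2) (tv 5),
   [A3 pR (tv 2) (tv 3) (tv 5), A2 (pLetter (NTM.blank M)) (tv 3) (tv 5),
    A2 pEnd (tv 3) (tv 5)] ++ brSetA (tv 3) (tv 5))

/-- The rule set `Σ_M` of Section 4 (simulating `M`, with the designated state `qr`). -/
def SigmaM (M : NTM) (qr : ℕ) : RuleSet :=
  [ruleBrake M, ruleNextBr] ++ transRules M qr ++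
    copyLeftRules M ++ copyRightRules M ++ [ruleEnd M]

/-- The constant `c_i` (0-based). -/
def cst (i : ℕ) : GroundTerm := Sum.inl (i + 1)
/-- The brake constant `w₁` of the database. -/
def w1 : GroundTerm := Sum.inl 0

/-- `brSet(x, w)` as facts. -/
def brSetF (x w : GroundTerm) : List Fact :=
  [(pF, [x, w, w]), (pR, [x, w, w]), (pReal, [x]), (pBrake, [w])]

/-- The database `D_ρ` encoding a configuration `ρ`. -/
def Drho (M : NTM) (ρ : Config) : Database :=
  ((List.range ρ.1.length).map fun i => ((pR, [cst i, cst (i + 1), w1]) : Fact)) ++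
  ((List.range ρ.1.length).map fun i => ((pLetter (ρ.1.getD i 0), [cst i, w1]) : Fact)) ++
  [((pState ρ.2.2, [cst ρ.2.1, w1]) : Fact),
   ((pLetter (NTM.blank M), [cst ρ.1.length, w1]) : Fact),
   ((pEnd, [cst ρ.1.length, w1]) : Fact)] ++
  (List.range (ρ.1.length + 1)).foldr (fun i acc => brSetF (cst i) w1 ++ acc) []

/-! ### Wild frontiers -/

/-- The atoms explicitly required by the wild-frontier condition ("other" atoms are those
not in this set). -/
def wfListed (M : NTM) (ρ : Config) (w : GroundTerm) (x : ℕ → GroundTerm) : Set Fact :=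
  {f | (∃ i < ρ.1.length,
          f = ((pR, [x i, x (i + 1), w]) : Fact) ∨
          f = ((pLetter (ρ.1.getD i 0), [x i, w]) : Fact)) ∨
    f = ((pState ρ.2.2, [x ρ.2.1, w]) : Fact) ∨
    f = ((pEnd, [x ρ.1.length, w]) : Fact) ∨
    f = ((pLetter (NTM.blank M), [x ρ.1.length, w]) : Fact) ∨
    (∃ i ≤ ρ.1.length, f ∈ brSetF (x i) w)}

/-- `F` has a wild frontier of the configuration `ρ` overseen by `w` (Definition 4.4). -/
def WildFrontier (M : NTM) (F : Set Fact) (ρ : Config) (w : GroundTerm) : Prop :=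
  ∃ x : ℕ → GroundTerm,
    ((pReal, [w]) : Fact) ∉ F ∧
    (∀ i < ρ.1.length, ((pR, [x i, x (i + 1), w]) : Fact) ∈ F ∧
      ((pLetter (ρ.1.getD i 0), [x i, w]) : Fact) ∈ F) ∧
    ((pState ρ.2.2, [x ρ.2.1, w]) : Fact) ∈ F ∧
    ((pEnd, [x ρ.1.length, w]) : Fact) ∈ F ∧
    ((pLetter (NTM.blank M), [x ρ.1.length, w]) : Fact) ∈ F ∧
    (∀ i ≤ ρ.1.length, ∀ f ∈ brSetF (x i) w, f ∈ F) ∧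
    (∀ f ∈ F, f ∉ wfListed M ρ w x →
      ∀ i ≤ ρ.1.length, f.2.head? = some (x i) → f.2[1]? = some w)

/-! ### State atoms, generation, bow ties -/

/-- `g` is a brake of `F`. -/
def isBrake (F : Set Fact) (g : GroundTerm) : Prop := ((pBrake, [g]) : Fact) ∈ F

/-- A state atom of `F`: an atom `q(x, w)` with `q` a state of `M` and `x` not a brake. -/
def StateAtom (M : NTM) (F : Set Fact) (f : Fact) : Prop :=
  ∃ q : ℕ, q < NTM.numStates M ∧ ∃ x wb : GroundTerm,
    f = ((pState q, [x, wb]) : Fact) ∧ f ∈ F ∧ ¬ isBrake F x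

/-- `A` precedes `A'` in the derivation `c`: some applied trigger has `A` in its support
and `A'` in its output. -/
def precedes {S : RuleSet} {D : Set Fact} (c : Chase S D) (A A' : Fact) : Prop :=
  ∃ i : ℕ, (i : ℕ∞) < c.len ∧ A ∈ support (c.trig i) ∧ A' ∈ outputOf (c.trig i) (c.ext i)

/-- The fact `f` is generated (newly produced) at step `i` of the derivation `c`. -/
def generatedAt {S : RuleSet} {D : Set Fact} (c : Chase S D) (i : ℕ) (f : Fact) : Prop :=
  (i : ℕ∞) < c.len ∧ f ∈ outputOf (c.trig i) (c.ext i) ∧ f ∉ c.fact i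

/-- The fact `f` is generated by (an application of) one of the rules in `Rs`. -/
def generatedBy {S : RuleSet} {D : Set Fact} (c : Chase S D) (Rs : List Rule) (f : Fact) : Prop :=
  ∃ i : ℕ, generatedAt c i f ∧ (c.trig i).1 ∈ Rs

/-- Semantically meaningful terms: all terms of `F` except the brakes. -/
def semterms (F : Set Fact) : Set GroundTerm := {g | g ∈ termsOf F ∧ ¬ isBrake F g}

/-- The edge relation `E_R`: `(x, y) ∈ E_R` iff `R(x, y, w) ∈ F` for some `w`. -/
def ER (F : Set Fact) (u v : GroundTerm) : Prop := ∃ w, ((pR, [u, v, w]) : Fact) ∈ F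

/-- The weakly connected component of `x` in the graph induced by `E` on the vertex set `V`. -/
def wcc {α : Type} (V : Set α) (E : α → α → Prop) (x : α) : Set α :=
  {z | z ∈ V ∧ Relation.ReflTransGen (fun u v => u ∈ V ∧ v ∈ V ∧ (E u v ∨ E v u)) x z}

/-- Directed tree rooted in `r` on the vertex set `V` with edge relation `E`. -/
def IsDirTree {α : Type} (V : Set α) (E : α → α → Prop) (r : α) : Prop :=
  r ∈ V ∧
  (∀ v ∈ V, Relation.ReflTransGen (fun u v' => u ∈ V ∧ v' ∈ V ∧ E u v') r v) ∧
  (∀ v ∈ V, v ≠ r → ∃! u, u ∈ V ∧ E u v) ∧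
  (∀ u ∈ V, ¬ E u r)

/-- A bow tie with center `(x, y)` (Definition 6.2): `V_x^{-y}` induces a directed tree on the
inverse edges rooted in `x`, `V_y^{-x}` induces a directed tree rooted in `y`, and the two
components partition `V`. -/
def IsBowTie {α : Type} (V : Set α) (E : α → α → Prop) (x y : α) : Prop :=
  x ∈ V ∧ y ∈ V ∧ E x y ∧
  IsDirTree (wcc (V \ {y}) E x) (fun u v => E v u) x ∧
  IsDirTree (wcc (V \ {x}) E y) E y ∧
  wcc (V \ {y}) E x ∩ wcc (V \ {x}) E y = ∅ ∧
  wcc (V \ {y}) E x ∪ wcc (V \ {x}) E y = V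

/-- `bowtie(A)` for a state atom `q(x, w)`: the weakly connected component of `x` in
`(semterms F, E_R)`. -/
def bowtieOf (F : Set Fact) (x : GroundTerm) : Set GroundTerm := wcc (semterms F) (ER F) x

/-- A maximal `E`-path in the vertex set `V`. -/
def IsMaxPath {α : Type} (V : Set α) (E : α → α → Prop) (l : List α) : Prop :=
  l ≠ [] ∧ (∀ z ∈ l, z ∈ V) ∧ List.Chain' E l ∧
  (∀ z ∈ V, ∀ a, l.head? = some a → ¬ E z a) ∧
  (∀ z ∈ V, ∀ a, l.getLast? = some a → ¬ E a z)

/-- `configs(A)` (Definition 6.4): one candidate configuration per maximal path of `bowtie(A)`. -/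
def configsOf (M : NTM) (F : Set Fact) (A : Fact) : Set (Set Fact) :=
  {S | ∃ q : ℕ, ∃ x w : GroundTerm, A = ((pState q, [x, w]) : Fact) ∧
    ∃ l : List GroundTerm, IsMaxPath (bowtieOf F x) (ER F) l ∧
      S = insert A
        ({f | ∃ z ∈ l, f ∈ brSetF z w} ∪
         {f | f ∈ F ∧ (f.1 = pR ∨ f.1 = pEnd ∨ ∃ a ∈ letters M, f.1 = pLetter a) ∧
           f.2 ≠ [] ∧ f.2.getLast? = some w ∧ ∀ z ∈ f.2.dropLast, z ∈ l})}

/-- Homomorphic embedding of fact sets: a map on nulls (fixing all constants) sending `S`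
into `T`. -/
def mapG (h : ℕ → GroundTerm) : GroundTerm → GroundTerm
  | Sum.inl cc => Sum.inl cc
  | Sum.inr n => h n

def mapFact (h : ℕ → GroundTerm) (f : Fact) : Fact := (f.1, f.2.map (mapG h))

def HomEmbeds (S T : Set Fact) : Prop := ∃ h : ℕ → GroundTerm, ∀ f ∈ S, mapFact h f ∈ T

end ChaseTermination
namespace ChaseTermination

/-! ### The machine `M_Σ` (Definition 4.1), modelled by its canonical runs

A run of `M_Σ` on the encoding of a database corresponds exactly to a restricted chase
derivation of `⟨Σ, D⟩` (step 4 of the procedure) together with the counter `j`; the machine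
visits its designated state `q_r` once each time `j` is incremented (step 5), so a run visits
`q_r` infinitely often iff the derivation is infinite and `jseq` is unbounded. -/

open scoped Classical in
/-- The value of the counter `j` of `M_Σ` after `i` iterations of its main loop, when its
non-deterministic choices build the chase derivation `c`. -/
noncomputable def jseq {S : RuleSet} {D : Set Fact} (c : Chase S D) : ℕ → ℕ
  | 0 => 0
  | i + 1 =>
      if ∀ t : Trigger, Active S (c.fact (jseq c i)) t → obsolete t (c.fact i) then
        jseq c i + 1
      else jseq c i

/-! ### Oblivious and core chase variants -/

/-- A (possibly infinite) oblivious chase derivation: triggers need only be loaded, but no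
trigger (instance) is ever applied twice. -/
structure OblChase (S : RuleSet) (D : Set Fact) where
  len : ℕ∞
  fact : ℕ → Set Fact
  trig : ℕ → Trigger
  ext : ℕ → ℕ → GroundTerm
  init : fact 0 = D
  memAt : ∀ i : ℕ, (i : ℕ∞) < len → (trig i).1 ∈ S
  loadAt : ∀ i : ℕ, (i : ℕ∞) < len → loaded (trig i) (fact i)
  noRepeat : ∀ i j : ℕ, (i : ℕ∞) < len → (j : ℕ∞) < len →
    instOf (trig i) = instOf (trig j) → i = j
  extOk : ∀ i : ℕ, (i : ℕ∞) < len → properExt (trig i) (fact i) (ext i)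
  succ : ∀ i : ℕ, (i : ℕ∞) < len → fact (i + 1) = fact i ∪ outputOf (trig i) (ext i)
  stall : ∀ i : ℕ, ¬ ((i : ℕ∞) < len) → fact (i + 1) = fact i

/-- Fairness for the oblivious chase: every trigger that becomes loaded is eventually applied. -/
def OblFair {S : RuleSet} {D : Set Fact} (c : OblChase S D) : Prop :=
  ∀ t : Trigger, t.1 ∈ S → ∀ i : ℕ, loaded t (c.fact i) →
    ∃ j : ℕ, (j : ℕ∞) < c.len ∧ instOf (c.trig j) = instOf t

/-- `H` is a retract of `G`: `H ⊆ G` and some homomorphism (fixing constants) maps `G` into `H`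
leaving `H` pointwise fixed. -/
def RetractOf (G H : Set Fact) : Prop :=
  H ⊆ G ∧ ∃ h : ℕ → GroundTerm, (∀ f ∈ G, mapFact h f ∈ H) ∧ ∀ f ∈ H, mapFact h f = f

/-- `H` is a core of `G`: a retract of `G` without proper retracts. -/
def IsCoreOf (H G : Set Fact) : Prop := RetractOf G H ∧ ∀ H', RetractOf H H' → H' = H

/-- `G` is obtained from `F` by applying all active triggers in parallel, each with fresh
pairwise distinct nulls (distinct trigger instances use disjoint fresh nulls). -/
def IsParallelStep (S : RuleSet) (F G : Set Fact) : Prop :=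
  ∃ pe : Trigger → (ℕ → GroundTerm),
    (∀ t : Trigger, Active S F t → properExt t F (pe t)) ∧
    (∀ t t' : Trigger, Active S F t → Active S F t' → instOf t = instOf t' →
      outputOf t (pe t) = outputOf t' (pe t')) ∧
    (∀ t t' : Trigger, Active S F t → Active S F t' → instOf t ≠ instOf t' →
      ∀ n : ℕ, (Sum.inr n : GroundTerm) ∉ termsOf F →
        (Sum.inr n : GroundTerm) ∈ termsOf (outputOf t (pe t)) →
        (Sum.inr n : GroundTerm) ∉ termsOf (outputOf t' (pe t'))) ∧
    G = F ∪ ⋃ t ∈ {t : Trigger | Active S F t}, outputOf t (pe t)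

/-- A (possibly infinite) core chase sequence: `F_{i+1}` is a core of the parallel application
of all active triggers to `F_i`, and the sequence stops exactly when this is a fixpoint. -/
structure CoreChase (S : RuleSet) (D : Set Fact) where
  len : ℕ∞
  fact : ℕ → Set Fact
  init : fact 0 = D
  step : ∀ i : ℕ, (i : ℕ∞) < len →
    ∃ G, IsParallelStep S (fact i) G ∧ IsCoreOf (fact (i + 1)) G ∧ fact (i + 1) ≠ fact i
  halt : ∀ i : ℕ, ¬ ((i : ℕ∞) < len) → ∃ G, IsParallelStep S (fact i) G ∧ IsCoreOf (fact i) G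
  stall : ∀ i : ℕ, ¬ ((i : ℕ∞) < len) → fact (i + 1) = fact i

/-- The three chase variants. -/
inductive Variant : Type | obl | rest | core

/-- `qExists` ("sometimes") and `qForall` ("always") termination. -/
inductive Quant : Type | qExists | qForall

/-- `Terminates v q S D`: the knowledge base `⟨S, D⟩` `q`-terminates for the chase variant `v`
(`qExists`: some chase sequence is finite; `qForall`: all chase sequences are finite). -/
def Terminates (v : Variant) (q : Quant) (S : RuleSet) (D : Set Fact) : Prop :=
  match v, q with
  | .rest, .qExists => ∃ c : Chase S D, Fair c ∧ c.len ≠ ⊤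
  | .rest, .qForall => ∀ c : Chase S D, Fair c → c.len ≠ ⊤
  | .obl, .qExists => ∃ c : OblChase S D, OblFair c ∧ c.len ≠ ⊤
  | .obl, .qForall => ∀ c : OblChase S D, OblFair c → c.len ≠ ⊤
  | .core, .qExists => ∃ c : CoreChase S D, c.len ≠ ⊤
  | .core, .qForall => ∀ c : CoreChase S D, c.len ≠ ⊤

end ChaseTermination

namespace ChaseTermination


/-! ### Recurrence in abstract transition systems -/

theorem exists_seq_of_forall_exists {α : Type*} {P : ℕ → α → Prop} {r : α → α → Prop} {a : α}
    (h0 : P 0 a) (h : ∀ i a, P i a → ∃ b, r a b ∧ P (i + 1) b) :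
    ∃ c : ℕ → α, c 0 = a ∧ ∀ i, P i (c i) ∧ r (c i) (c (i + 1)) := by
  choose! next hr hP using h
  let c : ℕ → α := fun n => Nat.rec a next n
  have hc : ∀ i, P i (c i) := fun i => by
    induction i with
    | zero => exact h0
    | succ i ih => exact hP i _ ih
  exact ⟨c, rfl, fun i => ⟨hc i, hr i _ (hc i)⟩⟩

/-- Some infinite `r`-path starting in `x` satisfies `P` infinitely often. -/
def Recur {α : Type*} (r : α → α → Prop) (P : α → Prop) (x : α) : Prop :=
  ∃ c : ℕ → α, c 0 = x ∧ (∀ i, r (c i) (c (i + 1))) ∧ ∀ n, ∃ i, n ≤ i ∧ P (c i)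

/-- Recurrence is witnessed by a path equipped with a countdown to the next `P`-element. -/
theorem recur_iff_countdown {α : Type*} {r : α → α → Prop} {P : α → Prop} {x : α} :
    Recur r P x ↔ ∃ s : ℕ → α × ℕ, (s 0).1 = x ∧ ∀ i, r (s i).1 (s (i + 1)).1 ∧
      ((s i).2 = 0 ∧ P (s i).1 ∨ (s i).2 = (s (i + 1)).2 + 1) := by
  classical
  constructor
  · rintro ⟨c, h0, hr, hP⟩
    have hex : ∀ n, ∃ d, P (c (n + d)) := fun n => by
      obtain ⟨i, hi, h⟩ := hP n
      exact ⟨i - n, by rwa [Nat.add_sub_cancel' hi]⟩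
    refine ⟨fun i => (c i, Nat.find (hex i)), h0, fun i => ⟨hr i, ?_⟩⟩
    rcases Nat.eq_zero_or_pos (Nat.find (hex i)) with h | h
    · left
      have := Nat.find_spec (hex i)
      rw [h] at this
      exact ⟨h, this⟩
    · right
      obtain ⟨d, hd⟩ := Nat.exists_eq_succ_of_ne_zero h.ne'
      have hs := Nat.find_spec (hex i)
      rw [hd] at hs
      show Nat.find (hex i) = Nat.find (hex (i + 1)) + 1
      rw [hd, Nat.succ_eq_add_one, Nat.add_right_cancel_iff, eq_comm, Nat.find_eq_iff]
      refine ⟨by rwa [Nat.add_assoc, Nat.add_comm 1], fun m hm hPm => ?_⟩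
      refine Nat.find_min (hex i) (m := m + 1) (by omega) ?_
      rwa [Nat.add_comm m, ← Nat.add_assoc]
  · rintro ⟨s, h0, hs⟩
    refine ⟨fun i => (s i).1, h0, fun i => (hs i).1, fun n => ?_⟩
    have key : ∀ m n, (s n).2 = m → ∃ i, n ≤ i ∧ P (s i).1 := by
      intro m
      induction m with
      | zero => intro n hn; exact ⟨n, le_rfl, by have := (hs n).2; grind⟩
      | succ m ih =>
        intro n hn
        obtain ⟨i, hi, h⟩ := ih (n + 1) (by have := (hs n).2; grind)
        exact ⟨i, by omega, h⟩
    exact key _ n rfl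

theorem Recur.map {α β : Type*} {r : α → α → Prop} {P : α → Prop} {s : β → β → Prop}
    {Q : β → Prop} {D : α → β → Prop}
    (hstep : ∀ a b a', D a b → r a a' → ∃ b', s b b' ∧ D a' b')
    (hPQ : ∀ a b, D a b → P a → Q b) {a : α} {b : β} (hab : D a b) (h : Recur r P a) :
    Recur s Q b := by
  obtain ⟨c, h0, hr, hP⟩ := h
  obtain ⟨d, hd0, hd⟩ := exists_seq_of_forall_exists (P := fun i b => D (c i) b) (r := s)
    (h0 ▸ hab) (fun i b hb => hstep _ _ _ hb (hr i))
  refine ⟨d, hd0, fun i => (hd i).2, fun n => ?_⟩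
  obtain ⟨i, hi, h⟩ := hP n
  exact ⟨i, hi, hPQ _ _ (hd i).1 h⟩

/-- Coinduction principle: a set of `P`-elements each of which reaches the set again. -/
theorem Recur.of_invariant {α : Type*} {r : α → α → Prop} {P : α → Prop} {S : α → Prop}
    (hSP : ∀ y, S y → P y) (hS : ∀ y, S y → ∃ z, S z ∧ Relation.TransGen r y z) {x : α}
    (hx : ∃ y, S y ∧ Relation.ReflTransGen r x y) : Recur r P x := by
  let W : α → ℕ → Prop := fun a m =>
    ∃ p : ℕ → α, p 0 = a ∧ (∀ i < m, r (p i) (p (i + 1))) ∧ S (p m)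
  have hW : ∀ {a z}, S z → Relation.ReflTransGen r a z → ∃ m, W a m := by
    intro a z hz h
    induction h using Relation.ReflTransGen.head_induction_on with
    | refl => exact ⟨0, fun _ => z, rfl, by simp, hz⟩
    | @head a _ h _ ih =>
      obtain ⟨m, p, hp, hr, hs⟩ := ih
      refine ⟨m + 1, fun i => Nat.casesOn i a p, rfl, ?_, hs⟩
      rintro (_ | i) hi
      · show r a (p 0)
        exact hp ▸ h
      · exact hr i (by omega)
  obtain ⟨y, hy, hxy⟩ := hx
  obtain ⟨m, hm⟩ := hW hy hxy
  obtain ⟨s, h0, hs⟩ := exists_seq_of_forall_exists (a := (x, m))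
    (P := fun _ (a : α × ℕ) => W a.1 a.2)
    (r := fun a b => r a.1 b.1 ∧ (a.2 = 0 ∧ P a.1 ∨ a.2 = b.2 + 1)) hm (by
      rintro - ⟨a, m⟩ ⟨p, rfl, hr, hs⟩
      cases m with
      | zero =>
        obtain ⟨z, hz, hyz⟩ := hS _ hs
        obtain ⟨b, hb, hbz⟩ := Relation.TransGen.head'_iff.1 hyz
        obtain ⟨k, hk⟩ := hW hz hbz
        exact ⟨(b, k), ⟨hb, .inl ⟨rfl, hSP _ hs⟩⟩, hk⟩
      | succ m =>
        exact ⟨(p 1, m), ⟨hr 0 (by omega), .inr rfl⟩, fun i => p (i + 1), rfl,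
          fun i hi => hr (i + 1) (by omega), hs⟩)
  exact recur_iff_countdown.2 ⟨s, by rw [h0], fun i => (hs i).2⟩

theorem recur_iff_of_unique_step {α : Type*} {r : α → α → Prop} {P : α → Prop} {x y : α}
    (hxy : r x y) (huniq : ∀ z, r x z → z = y) : Recur r P x ↔ Recur r P y := by
  constructor
  · rintro ⟨c, h0, hr, hP⟩
    refine ⟨fun i => c (i + 1), huniq _ (h0 ▸ hr 0), fun i => hr _, fun n => ?_⟩
    obtain ⟨i, hi, h⟩ := hP (n + 1)
    refine ⟨i - 1, by omega, ?_⟩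
    show P (c (i - 1 + 1))
    rwa [Nat.sub_add_cancel (by omega)]
  · rintro ⟨c, h0, hr, hP⟩
    refine ⟨fun i => Nat.casesOn i x c, rfl, ?_, fun n => ?_⟩
    · rintro (_ | i)
      · show r x (c 0)
        exact h0 ▸ hxy
      · exact hr i
    · obtain ⟨i, hi, h⟩ := hP n
      exact ⟨i + 1, by omega, h⟩

/-! ### Nondeterministic programs on a one-way infinite tape -/

/-- A tape filled with symbols, together with a head position. -/
abbrev TapeState : Type := (ℕ → ℕ) × ℕ

/-- `HeadMove d p p'`: the head moves from `p` to `p'`, to the right iff `d = true`. -/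
def HeadMove (d : Bool) (p p' : ℕ) : Prop := if d then p' = p + 1 else p = p' + 1

/-- Regular programs whose atoms rewrite the current cell according to a relation and then
move the head. -/
inductive TapeProg : Type
  | step (A : ℕ → ℕ → Prop) (d : Bool)
  | seq (p q : TapeProg)
  | star (p : TapeProg)

/-- The input-output relation of a program over the symbols `0, …, N - 1`. -/
def TapeProg.Sem (N : ℕ) : TapeProg → TapeState → TapeState → Prop
  | .step A d => fun τ τ' => ∃ b, A (τ.1 τ.2) b ∧ b < N ∧
      τ'.1 = Function.update τ.1 τ.2 b ∧ HeadMove d τ.2 τ'.2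
  | .seq p q => Relation.Comp (p.Sem N) (q.Sem N)
  | .star p => Relation.ReflTransGen (p.Sem N)

/-- The relation of a stack of programs executed one after the other. -/
def stackSem (N : ℕ) : List TapeProg → TapeState → TapeState → Prop
  | [] => fun τ τ' => τ = τ'
  | p :: k => Relation.Comp (p.Sem N) (stackSem N k)

/-- Control states: a stack of programs, and a flag for the second half of an idle move. -/
abbrev Ctrl : Type := List TapeProg × Bool

/-- Unfolding of the stack without touching the tape; the empty stack restarts `body`. -/
inductive Unfold (body : TapeProg) : List TapeProg → List TapeProg → Prop
  | restart : Unfold body [] [body]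
  | seq (p q k) : Unfold body (.seq p q :: k) (p :: q :: k)
  | leave (p k) : Unfold body (.star p :: k) k
  | iter (p k) : Unfold body (.star p :: k) (p :: .star p :: k)

/-- Transition relation of the program automaton. An unfolding is realised by a move to the
right followed by a move to the left. -/
inductive CtrlStep (N : ℕ) (body : TapeProg) : Ctrl → ℕ → Ctrl → ℕ → Bool → Prop
  | act {A d k a b} : A a b → a < N → b < N →
      CtrlStep N body (.step A d :: k, false) a (k, false) b d
  | out {c c' a} : Unfold body c c' → a < N → CtrlStep N body (c, false) a (c', true) a true
  | back {c a} : a < N → CtrlStep N body (c, true) a (c, false) a false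

/-- One step of the program automaton on its configurations. -/
def ProgStep (N : ℕ) (body : TapeProg) (x y : Ctrl × TapeState) : Prop :=
  ∃ b d, CtrlStep N body x.1 (x.2.1 x.2.2) y.1 b d ∧
    y.2.1 = Function.update x.2.1 x.2.2 b ∧ HeadMove d x.2.2 y.2.2

/-- All symbols on the tape are smaller than `N`. -/
def SymbolsBelow (N : ℕ) (τ : TapeState) : Prop := ∀ j, τ.1 j < N

theorem SymbolsBelow.update {N : ℕ} {τ : TapeState} (h : SymbolsBelow N τ) {p b p' : ℕ}
    (hb : b < N) : SymbolsBelow N (Function.update τ.1 p b, p') := by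
  intro j
  by_cases hj : j = p
  · subst hj; simpa using hb
  · simpa [hj] using h j

theorem reflTransGen_of_unfold {N : ℕ} {body : TapeProg} {c c' : List TapeProg} {τ : TapeState}
    (hu : Unfold body c c') (h : SymbolsBelow N τ) :
    Relation.TransGen (ProgStep N body) ((c, false), τ) ((c', false), τ) := by
  refine .trans (.single (b := ((c', true), (τ.1, τ.2 + 1))) ?_) (.single ?_)
  · exact ⟨_, _, .out hu (h _), (Function.update_eq_self _ _).symm, by simp [HeadMove]⟩
  · exact ⟨_, _, .back (h _), (Function.update_eq_self _ _).symm, by simp [HeadMove]⟩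

theorem TapeProg.Sem.reflTransGen {N : ℕ} {body : TapeProg} (p : TapeProg) :
    ∀ {k : List TapeProg} {τ τ' : TapeState}, p.Sem N τ τ' → SymbolsBelow N τ →
      Relation.ReflTransGen (ProgStep N body) ((p :: k, false), τ) ((k, false), τ') ∧
        SymbolsBelow N τ' := by
  induction p with
  | step A d =>
    rintro k τ τ' ⟨b, hA, hb, hT, hm⟩ h
    refine ⟨.single ⟨b, d, .act hA (h _) hb, hT, hm⟩, ?_⟩
    have := h.update (p := τ.2) (p' := τ'.2) hb
    rwa [← hT] at this
  | seq p q ihp ihq =>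
    rintro k τ τ' ⟨τ₁, h₁, h₂⟩ h
    obtain ⟨r₁, hb₁⟩ := ihp (k := q :: k) h₁ h
    obtain ⟨r₂, hb₂⟩ := ihq (k := k) h₂ hb₁
    exact ⟨((reflTransGen_of_unfold (.seq p q k) h).to_reflTransGen.trans r₁).trans r₂, hb₂⟩
  | star p ih =>
    intro k τ τ' hs h
    induction hs using Relation.ReflTransGen.head_induction_on with
    | refl => exact ⟨(reflTransGen_of_unfold (.leave p k) h).to_reflTransGen, h⟩
    | head h₁ _ ih' =>
      obtain ⟨r₁, hb₁⟩ := ih (k := .star p :: k) h₁ h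
      obtain ⟨r₂, hb₂⟩ := ih' hb₁
      exact ⟨((reflTransGen_of_unfold (.iter p k) h).to_reflTransGen.trans r₁).trans r₂, hb₂⟩

theorem stackSem.reflTransGen {N : ℕ} {body : TapeProg} (k : List TapeProg) :
    ∀ {τ τ' : TapeState}, stackSem N k τ τ' → SymbolsBelow N τ →
      Relation.ReflTransGen (ProgStep N body) ((k, false), τ) (([], false), τ') ∧
        SymbolsBelow N τ' := by
  induction k with
  | nil => rintro τ _ rfl h; exact ⟨.refl, h⟩
  | cons p k ih =>
    rintro τ τ' ⟨τ₁, h₁, h₂⟩ h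
    obtain ⟨r₁, hb₁⟩ := h₁.reflTransGen (body := body) (k := k) p h
    obtain ⟨r₂, hb₂⟩ := ih h₂ hb₁
    exact ⟨r₁.trans r₂, hb₂⟩

/-- The relation still to be executed in a configuration of the program automaton. -/
def residualSem (N : ℕ) (x : Ctrl × TapeState) (τ : TapeState) : Prop :=
  ∀ p, x.2.2 = p + x.1.2.toNat → stackSem N x.1.1 (x.2.1, p) τ

theorem stackSem_of_unfold {N : ℕ} {body : TapeProg} {c c' : List TapeProg}
    (hu : Unfold body c c') (hc : c ≠ []) {τ τ' : TapeState} (h : stackSem N c' τ τ') :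
    stackSem N c τ τ' := by
  cases hu with
  | restart => exact absurd rfl hc
  | seq p q k =>
    obtain ⟨τ₁, h₁, τ₂, h₂, h₃⟩ := h
    exact ⟨τ₂, ⟨τ₁, h₁, h₂⟩, h₃⟩
  | leave p k => exact ⟨τ, .refl, h⟩
  | iter p k =>
    obtain ⟨τ₁, h₁, τ₂, h₂, h₃⟩ := h
    exact ⟨τ₂, .head h₁ h₂, h₃⟩

theorem residualSem_of_progStep {N : ℕ} {body : TapeProg} {x y : Ctrl × TapeState}
    (h : ProgStep N body x y) (hx : x.1 ≠ ([], false)) {τ : TapeState}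
    (hy : residualSem N y τ) : residualSem N x τ := by
  obtain ⟨⟨c, f⟩, T, p⟩ := x
  obtain ⟨⟨c', f'⟩, T', p'⟩ := y
  obtain ⟨b, d, hs, hT, hm⟩ := h
  simp only at hs hT hm
  intro p₀ hp
  obtain rfl : p = p₀ + f.toNat := hp
  cases hs with
  | act hA ha hb => exact ⟨(T', p'), ⟨b, hA, hb, hT, hm⟩, hy p' rfl⟩
  | out hu ha =>
    have := hy p₀ (by simpa [HeadMove] using hm)
    rw [show T' = T by rw [hT]; exact Function.update_eq_self _ _] at this
    exact stackSem_of_unfold hu (by rintro rfl; exact hx rfl) this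
  | back ha =>
    have := hy p₀ (by simpa [HeadMove, eq_comm] using hm)
    rwa [show T' = T by rw [hT]; exact Function.update_eq_self _ _] at this

theorem residualSem_of_path {N : ℕ} {body : TapeProg} {c : ℕ → Ctrl × TapeState}
    (hr : ∀ i, ProgStep N body (c i) (c (i + 1))) {j : ℕ} (hj : (c j).1 = ([], false)) :
    ∀ d i, i + d = j → (∀ t, i ≤ t → t < j → (c t).1 ≠ ([], false)) →
      residualSem N (c i) (c j).2 := by
  intro d
  induction d with
  | zero =>
    rintro i rfl _ p hp
    rw [add_zero, show (c i).1 = ([], false) from hj] at *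
    exact Prod.ext rfl (by simpa using hp.symm)
  | succ d ih =>
    intro i hi hne
    exact residualSem_of_progStep (hr i) (hne i le_rfl (by omega))
      (ih (i + 1) (by omega) fun t ht => hne t (by omega))

/-- The program automaton recurs through the empty stack iff `body` can be iterated forever. -/
theorem recur_progStep_iff {N : ℕ} {body : TapeProg} {k : List TapeProg} {τ : TapeState}
    (hτ : SymbolsBelow N τ) :
    Recur (ProgStep N body) (fun x => x.1 = ([], false)) ((k, false), τ) ↔
      ∃ u : ℕ → TapeState, stackSem N k τ (u 0) ∧ ∀ i, body.Sem N (u i) (u (i + 1)) := by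
  classical
  constructor
  · rintro ⟨c, h0, hr, hP⟩
    let V : ℕ → Prop := fun t => (c t).1 = ([], false)
    have hinf : (Set.ofPred V).Infinite := Set.infinite_of_not_bddAbove fun ⟨m, hm⟩ => by
      obtain ⟨i, hi, h⟩ := hP (m + 1)
      have : i ≤ m := hm h
      omega
    have hV : ∀ i, V (Nat.nth V i) := Nat.nth_mem_of_infinite hinf
    refine ⟨fun i => (c (Nat.nth V i)).2, ?_, fun i => ?_⟩
    · have := residualSem_of_path hr (hV 0) _ 0 (zero_add _) fun t _ ht hVt => by
        rw [← Nat.nth_count (p := V) hVt, Nat.nth_lt_nth hinf] at ht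
        omega
      rw [h0] at this
      exact this τ.2 rfl
    · have hlt : Nat.nth V i < Nat.nth V (i + 1) := (Nat.nth_lt_nth hinf).2 (by omega)
      have := residualSem_of_path hr (hV (i + 1)) _ (Nat.nth V i + 1)
        (Nat.add_sub_cancel' hlt) fun t ht₁ ht₂ hVt => by
          rw [← Nat.nth_count (p := V) hVt, Nat.nth_lt_nth hinf] at ht₂
          have : Nat.nth V i < Nat.nth V (Nat.count V t) := by
            rw [Nat.nth_count (p := V) hVt]; omega
          rw [Nat.nth_lt_nth hinf] at this
          omega
      obtain ⟨b, d, hs, hT, hm⟩ := hr (Nat.nth V i)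
      have hi : (c (Nat.nth V i)).1 = ([], false) := hV i
      show body.Sem N (c (Nat.nth V i)).2 (c (Nat.nth V (i + 1))).2
      generalize c (Nat.nth V i) = x at *
      generalize c (Nat.nth V i + 1) = y at *
      obtain ⟨q, T, p⟩ := x
      obtain ⟨q', T', p'⟩ := y
      obtain rfl : q = ([], false) := hi
      cases hs with
      | out hu ha =>
        cases hu
        obtain ⟨τ₁, h₁, h₂⟩ := this p (by simpa [HeadMove] using hm)
        rw [show T' = T by simp only at hT; rw [hT]; exact Function.update_eq_self _ _] at h₁
        obtain rfl : τ₁ = _ := h₂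
        exact h₁
  · rintro ⟨u, h0, hu⟩
    obtain ⟨hr, hb⟩ := h0.reflTransGen (body := body) k hτ
    refine Recur.of_invariant (S := fun x => ∃ i, x = (([], false), u i) ∧ SymbolsBelow N (u i))
      ?_ ?_ ⟨_, ⟨0, rfl, hb⟩, hr⟩
    · rintro _ ⟨i, rfl, -⟩; rfl
    · rintro _ ⟨i, rfl, h⟩
      obtain ⟨r, hb⟩ := (hu i).reflTransGen (body := body) (k := []) body h
      exact ⟨_, ⟨i + 1, rfl, hb⟩, (reflTransGen_of_unfold .restart h).trans_left r⟩

/-- The stacks occurring while the program `p` is executed on top of `k`. -/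
def TapeProg.stackSet : TapeProg → List TapeProg → Set (List TapeProg)
  | .step A d, k => {.step A d :: k}
  | .seq p q, k => {.seq p q :: k} ∪ p.stackSet (q :: k) ∪ q.stackSet k
  | .star p, k => {.star p :: k} ∪ p.stackSet (.star p :: k)

theorem TapeProg.cons_mem_stackSet (p : TapeProg) (k : List TapeProg) : p :: k ∈ p.stackSet k := by
  cases p <;> simp [stackSet]

theorem TapeProg.finite_stackSet (p : TapeProg) : ∀ k, (p.stackSet k).Finite := by
  induction p with
  | step A d => intro k; exact Set.finite_singleton _
  | seq p q ihp ihq => intro k; exact ((Set.finite_singleton _).union (ihp _)).union (ihq _)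
  | star p ih => intro k; exact (Set.finite_singleton _).union (ih _)

theorem TapeProg.mem_stackSet_of_unfold (p : TapeProg) {body : TapeProg} :
    ∀ {k c c'}, c ∈ p.stackSet k → (Unfold body c c' ∨ ∃ A d, c = .step A d :: c') →
      c' ∈ p.stackSet k ∨ c' = k := by
  induction p with
  | step A d =>
    rintro k c c' rfl (h | ⟨A', d', h⟩)
    · cases h
    · exact .inr (List.cons_eq_cons.1 h).2.symm
  | seq p q ihp ihq =>
    rintro k c c' ((rfl | hc) | hc) h
    · obtain h | ⟨A', d', h⟩ := h
      · cases h; exact .inl (.inl (.inr (p.cons_mem_stackSet _)))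
      · cases h
    · obtain h | rfl := ihp hc h
      · exact .inl (.inl (.inr h))
      · exact .inl (.inr (q.cons_mem_stackSet _))
    · obtain h | rfl := ihq hc h
      · exact .inl (.inr h)
      · exact .inr rfl
  | star p ih =>
    rintro k c c' (rfl | hc) h
    · obtain h | ⟨A', d', h⟩ := h
      · cases h
        · exact .inr rfl
        · exact .inl (.inr (p.cons_mem_stackSet _))
      · cases h
    · obtain h | rfl := ih hc h
      · exact .inl (.inr h)
      · exact .inl (.inl rfl)

/-- A finite set of control states that contains `([p], false)`, the recurring state and all
their successors. -/
theorem exists_finite_ctrl_set (N : ℕ) (p body : TapeProg) :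
    ∃ Q : Set Ctrl, Q.Finite ∧ ([p], false) ∈ Q ∧ ([], false) ∈ Q ∧
      ∀ q ∈ Q, ∀ a q' b d, CtrlStep N body q a q' b d → q' ∈ Q := by
  let C : Set (List TapeProg) := {[]} ∪ p.stackSet [] ∪ body.stackSet []
  have hC : ∀ c ∈ C, ∀ c', (Unfold body c c' ∨ ∃ A d, c = .step A d :: c') → c' ∈ C := by
    rintro c ((rfl | hc) | hc) c' h
    · obtain h | ⟨A, d, h⟩ := h
      · cases h; exact .inr (body.cons_mem_stackSet _)
      · cases h
    · obtain h | rfl := p.mem_stackSet_of_unfold hc h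
      · exact .inl (.inr h)
      · exact .inl (.inl rfl)
    · obtain h | rfl := body.mem_stackSet_of_unfold hc h
      · exact .inr h
      · exact .inl (.inl rfl)
  refine ⟨C ×ˢ Set.univ, Set.Finite.prod (((Set.finite_singleton _).union
    (p.finite_stackSet _)).union (body.finite_stackSet _)) Set.finite_univ,
    ⟨.inl (.inr (p.cons_mem_stackSet _)), trivial⟩, ⟨.inl (.inl rfl), trivial⟩, ?_⟩
  rintro q ⟨hq, -⟩ a q' b d h
  refine ⟨?_, trivial⟩
  cases h with
  | act hA ha hb => exact hC _ hq _ (.inr ⟨_, _, rfl⟩)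
  | out hu ha => exact hC _ hq _ (.inl hu)
  | back ha => exact hq


/-! ### Realising program automata by Turing machines -/

/-- Blank cells, coded by `N`, are read as the symbol `0`. -/
def readSymbol (N a : ℕ) : ℕ := if a = N then 0 else a

theorem exists_numbering {Q : Set Ctrl} (hQ : Q.Finite) :
    ∃ (num : Ctrl → ℕ) (S : ℕ), Set.InjOn num Q ∧ ∀ q ∈ Q, 0 < num q ∧ num q < S := by
  classical
  have hmem : ∀ q ∈ Q, q ∈ hQ.toFinset.toList := by simp
  refine ⟨fun q => hQ.toFinset.toList.idxOf q + 1, hQ.toFinset.toList.length + 1, ?_, ?_⟩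
  · intro q hq q' _ h
    exact (List.idxOf_inj (hmem q hq)).1 (Nat.succ.inj h)
  · intro q hq
    exact ⟨Nat.succ_pos _, Nat.succ_lt_succ (List.idxOf_lt_length_of_mem (hmem q hq))⟩

/-- `E` is the transition table of the program automaton restricted to the control states `Q`,
with states numbered by `num`. -/
def IsCtrlTable (N : ℕ) (body : TapeProg) (Q : Set Ctrl) (num : Ctrl → ℕ)
    (E : List ((ℕ × ℕ) × (ℕ × ℕ × Bool))) : Prop :=
  ∀ e, e ∈ E ↔ ∃ q ∈ Q, ∃ q' a b d, CtrlStep N body q (readSymbol N a) q' b d ∧ a ≤ N ∧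
    e = ((num q, a), (num q', b, d))

theorem CtrlStep.lt {N : ℕ} {body : TapeProg} {q q' : Ctrl} {a b : ℕ} {d : Bool}
    (h : CtrlStep N body q a q' b d) : b < N := by
  cases h <;> assumption

theorem exists_isCtrlTable {N S : ℕ} {body : TapeProg} {Q : Set Ctrl} {num : Ctrl → ℕ}
    (hnum : ∀ q ∈ Q, 0 < num q ∧ num q < S)
    (hQ : ∀ q ∈ Q, ∀ a q' b d, CtrlStep N body q a q' b d → q' ∈ Q) :
    ∃ E, IsCtrlTable N body Q num E := by
  classical
  let B : Set ((ℕ × ℕ) × (ℕ × ℕ × Bool)) := {e | ∃ q ∈ Q, ∃ q' a b d,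
    CtrlStep N body q (readSymbol N a) q' b d ∧ a ≤ N ∧ e = ((num q, a), (num q', b, d))}
  have hB : B.Finite := by
    refine Set.Finite.subset (((Set.finite_Iio S).prod (Set.finite_Iic N)).prod
      ((Set.finite_Iio S).prod ((Set.finite_Iio N).prod (Set.finite_univ (α := Bool))))) ?_
    rintro _ ⟨q, hq, q', a, b, d, h, ha, rfl⟩
    exact ⟨⟨(hnum q hq).2, ha⟩, (hnum q' (hQ q hq _ _ _ _ h)).2, h.lt, trivial⟩
  exact ⟨hB.toFinset.toList, fun e => by rw [Finset.mem_toList, hB.mem_toFinset]; rfl⟩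

/-- The Turing machine configuration `ρ` represents `x`. -/
def Represents (N : ℕ) (Q : Set Ctrl) (num : Ctrl → ℕ) (ρ : Config) (x : Ctrl × TapeState) :
    Prop :=
  x.1 ∈ Q ∧ ρ.2.2 = num x.1 ∧ ρ.2.1 = x.2.2 ∧ x.2.2 < ρ.1.length ∧
    ∀ j, ρ.1.getD j N ≤ N ∧ readSymbol N (ρ.1.getD j N) = x.2.1 j

theorem getD_set_append {N : ℕ} {l : List ℕ} {p b : ℕ} (hp : p < l.length) (j : ℕ) :
    (l.set p b ++ [N]).getD j N = if j = p then b else l.getD j N := by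
  grind

section Simulation

variable {N : ℕ} {body : TapeProg} {Q : Set Ctrl} {num : Ctrl → ℕ} {M : NTM}

theorem Represents.update {q q' : Ctrl} {T : ℕ → ℕ} {p p' b : ℕ} {ρ : Config}
    (h : Represents N Q num ρ (q, T, p)) (hq' : q' ∈ Q) (hb : b < N) {d : Bool}
    (hm : HeadMove d p p') :
    Represents N Q num (ρ.1.set ρ.2.1 b ++ [N], p', num q') (q', Function.update T p b, p') := by
  obtain ⟨-, -, hp, hlt, hT⟩ := h
  simp only at hp hlt hT
  rw [hp]
  refine ⟨hq', rfl, rfl, ?_, fun j => ?_⟩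
  · cases d <;> simp [HeadMove] at hm ⊢ <;> omega
  · simp only [getD_set_append hlt]
    by_cases hj : j = p
    · simp [hj, hb.le, readSymbol, hb.ne]
    · simpa [hj] using hT j

theorem Represents.progStep (hE : ∀ e : (ℕ × ℕ) × (ℕ × ℕ × Bool), (∃ q ∈ Q, e.1.1 = num q) →
      (e ∈ NTM.table M ↔ ∃ q ∈ Q, ∃ q' a b d,
        CtrlStep N body q (readSymbol N a) q' b d ∧ a ≤ N ∧ e = ((num q, a), (num q', b, d))))
    (hM : NTM.blank M = N) (hinj : Set.InjOn num Q)
    (hQ : ∀ q ∈ Q, ∀ a q' b d, CtrlStep N body q a q' b d → q' ∈ Q)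
    {ρ ρ' : Config} {x : Ctrl × TapeState} (h : Represents N Q num ρ x)
    (hn : NTM.Next M ρ ρ') : ∃ y, ProgStep N body x y ∧ Represents N Q num ρ' y := by
  obtain ⟨q, T, p⟩ := x
  have h' := h
  obtain ⟨hq, hst, hp, hlt, hT⟩ := h
  simp only at hq hst hp hlt hT
  obtain ⟨q₁, b, d, he, hd, rfl⟩ := hn
  obtain ⟨q₂, hq₂, q', a, b', d', hs, ha, heq⟩ := (hE _ ⟨q, hq, hst⟩).1 he
  simp only [Prod.mk.injEq] at heq
  obtain ⟨⟨h₁, h₂⟩, rfl, rfl, rfl⟩ := heq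
  obtain rfl := hinj hq hq₂ (hst.symm.trans h₁)
  have hread : readSymbol N a = T p := by
    rw [← (hT p).2, ← h₂, hp]
    congr 1
    grind
  have hm : HeadMove d p (if d then ρ.2.1 + 1 else ρ.2.1 - 1) := by
    cases d <;> simp [HeadMove, hp] at hd ⊢
    omega
  rw [hread] at hs
  exact ⟨(q', Function.update T p b, _), ⟨b, d, hs, rfl, hm⟩,
    hM ▸ h'.update (hQ q hq _ _ _ _ hs) hs.lt hm⟩

theorem Represents.next (hE : ∀ e : (ℕ × ℕ) × (ℕ × ℕ × Bool), (∃ q ∈ Q, e.1.1 = num q) →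
      (e ∈ NTM.table M ↔ ∃ q ∈ Q, ∃ q' a b d,
        CtrlStep N body q (readSymbol N a) q' b d ∧ a ≤ N ∧ e = ((num q, a), (num q', b, d))))
    (hM : NTM.blank M = N)
    (hQ : ∀ q ∈ Q, ∀ a q' b d, CtrlStep N body q a q' b d → q' ∈ Q)
    {ρ : Config} {x y : Ctrl × TapeState} (h : Represents N Q num ρ x)
    (hn : ProgStep N body x y) : ∃ ρ', NTM.Next M ρ ρ' ∧ Represents N Q num ρ' y := by
  obtain ⟨q, T, p⟩ := x
  obtain ⟨q', T', p'⟩ := y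
  have h' := h
  obtain ⟨hq, hst, hp, hlt, hT⟩ := h
  obtain ⟨b, d, hs, hT', hm⟩ := hn
  simp only at hq hst hp hlt hT hs hT' hm
  subst hT'
  refine ⟨_, ⟨num q', b, d, ?_, ?_, rfl⟩, ?_⟩
  · refine (hE _ ⟨q, hq, hst⟩).2 ⟨q, hq, q', ρ.1.getD p N, b, d, ?_, (hT p).1, ?_⟩
    · rwa [(hT p).2]
    · rw [hst, hp]
      congr 2
      grind
  · cases d <;> simp [HeadMove, hp] at hm ⊢
    omega
  · rw [hM, show (if d then ρ.2.1 + 1 else ρ.2.1 - 1) = p' by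
      cases d <;> simp [HeadMove, hp] at hm ⊢ <;> omega]
    exact h'.update (hQ q hq _ _ _ _ hs) hs.lt hm

end Simulation

/-- The machine that writes `home` and `c` copies of `one`, and then enters the state `q₀` of the
table `E`. -/
def chainMachine (N base q₀ home one : ℕ) (E : List ((ℕ × ℕ) × (ℕ × ℕ × Bool))) (c : ℕ) : NTM :=
  (base + c + 1, N, ((0, N), (base, home, true)) :: ((base + c, N), (q₀, 0, false)) ::
    ((List.range c).map (fun i => ((base + i, N), (base + i + 1, one, true))) ++ E))

/-- The tape produced by the initial phase of `chainMachine`. -/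
def chainTape (home one c : ℕ) : ℕ → ℕ := fun j =>
  if j = 0 then home else if j ≤ c then one else 0

theorem getD_chain (N home one c j : ℕ) :
    (home :: List.replicate c one ++ [0] ++ [N]).getD j N =
      if j = 0 then home else if j ≤ c then one else if j = c + 1 then 0 else N := by
  rcases j with _ | j
  · simp
  · simp only [List.append_assoc, List.cons_append, List.nil_append,
      List.getD_eq_getElem?_getD, List.getElem?_cons_succ]
    rcases lt_trichotomy j c with h | rfl | h
    · rw [List.getElem?_append_left (by simpa using h)]
      simp [h, Nat.succ_le_of_lt h]
    · simp
    · rw [List.getElem?_append_right (by simpa using h.le)]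
      obtain ⟨k, rfl⟩ := Nat.exists_eq_add_of_lt h
      have h₁ : ¬ c + k + 1 + 1 ≤ c := by omega
      have h₂ : c + k + 1 - c = k + 1 := by omega
      rcases k with _ | k <;> simp [h₁, h₂]; omega

theorem exists_chainMachine {N home one : ℕ} (hN : 2 ≤ N) (hh : home < N) (h1 : one < N)
    (p body : TapeProg) :
    ∃ base q₀ qr E, ∀ c, NTM.WF (chainMachine N base q₀ home one E c) ∧
      qr < NTM.numStates (chainMachine N base q₀ home one E c) ∧
      (RecurringFrom (chainMachine N base q₀ home one E c) qr
        (startConfig (chainMachine N base q₀ home one E c) []) ↔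
        Recur (ProgStep N body) (fun x => x.1 = ([], false))
          (([p], false), (chainTape home one c, c))) := by
  obtain ⟨Q, hfin, hp, hnil, hQ⟩ := exists_finite_ctrl_set N p body
  obtain ⟨num, base, hinj, hnum⟩ := exists_numbering hfin
  obtain ⟨E, hE⟩ := exists_isCtrlTable hnum hQ
  refine ⟨base, num ([p], false), num ([], false), E, fun c => ?_⟩
  set M := chainMachine N base (num ([p], false)) home one E c with hMdef
  have hpb := hnum _ hp
  have hmem : ∀ e, e ∈ NTM.table M ↔ e = ((0, N), (base, home, true)) ∨
      e = ((base + c, N), (num ([p], false), 0, false)) ∨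
      (∃ i < c, ((base + i, N), (base + i + 1, one, true)) = e) ∨ e ∈ E := fun e => by
    simp [hMdef, NTM.table, chainMachine]
  have hEb : ∀ e ∈ E, 0 < e.1.1 ∧ e.1.1 < base := fun e he => by
    obtain ⟨q, hq, q', a, b, d, -, -, rfl⟩ := (hE e).1 he
    exact hnum q hq
  have hblank : NTM.blank M = N := rfl
  have hstates : NTM.numStates M = base + c + 1 := rfl
  refine ⟨⟨by omega, hN, fun e he => ?_⟩, by have := hnum _ hnil; omega, ?_⟩
  · rw [hblank, hstates]
    rcases (hmem e).1 he with rfl | rfl | ⟨i, hi, rfl⟩ | he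
    · exact ⟨by dsimp; omega, le_rfl, by dsimp; omega, hh⟩
    · exact ⟨by dsimp; omega, le_rfl, by dsimp; omega, by dsimp; omega⟩
    · exact ⟨by dsimp; omega, le_rfl, by dsimp; omega, h1⟩
    · obtain ⟨q, hq, q', a, b, d, hs, ha, rfl⟩ := (hE e).1 he
      have h₁ := hnum q hq
      have h₂ := hnum q' (hQ q hq _ _ _ _ hs)
      exact ⟨by dsimp; omega, ha, by dsimp; omega, hs.lt⟩
  -- the initial phase is deterministic
  let ρ : ℕ → Config := fun i => (home :: List.replicate i one ++ [N], i + 1, base + i)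
  have hget : ∀ i, (home :: List.replicate i one ++ [N]).getD (i + 1) 0 = N := fun i => by simp
  have hset : ∀ i b, (home :: List.replicate i one ++ [N]).set (i + 1) b =
      home :: List.replicate i one ++ [b] := fun i b => by simp
  have e₁ : Recur (NTM.Next M) (fun ρ => ρ.2.2 = num ([], false)) (startConfig M []) ↔
      Recur (NTM.Next M) (fun ρ => ρ.2.2 = num ([], false)) (ρ 0) := by
    refine recur_iff_of_unique_step ?_ ?_
    · exact ⟨base, home, true, (hmem _).2 (.inl rfl), .inl rfl, rfl⟩
    · rintro _ ⟨q', b, d, he, hd, rfl⟩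
      rcases (hmem _).1 he with h | h | ⟨i, hi, h⟩ | h
      · obtain ⟨-, rfl, rfl, rfl⟩ := by simpa only [Prod.mk.injEq] using h
        rfl
      · simp [startConfig] at h; omega
      · simp [startConfig] at h; omega
      · have := hEb _ h
        simp [startConfig] at this
  have e₂ : ∀ i ≤ c, Recur (NTM.Next M) (fun ρ => ρ.2.2 = num ([], false)) (startConfig M []) ↔
      Recur (NTM.Next M) (fun ρ => ρ.2.2 = num ([], false)) (ρ i) := by
    intro i
    induction i with
    | zero => exact fun _ => e₁
    | succ i ih =>
      intro hi
      rw [ih (by omega)]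
      have hnext : ρ (i + 1) = ((ρ i).1.set (ρ i).2.1 one ++ [N], (ρ i).2.1 + 1, base + i + 1) := by
        simp only [ρ, hset]
        rw [List.replicate_succ']
        simp [add_assoc]
      refine recur_iff_of_unique_step ?_ ?_
      · refine ⟨base + i + 1, one, true, (hmem _).2 (.inr (.inr (.inl ⟨i, by omega, ?_⟩))),
          .inl rfl, hnext⟩
        simp only [ρ, hget]
      · rintro _ ⟨q', b, d, he, hd, rfl⟩
        rw [hnext]
        rcases (hmem _).1 he with h | h | ⟨j, hj, h⟩ | h
        · simp [ρ] at h; omega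
        · simp [ρ] at h; omega
        · simp only [ρ, hget, Prod.mk.injEq] at h
          obtain ⟨⟨h, -⟩, h', rfl, rfl⟩ := h
          obtain rfl : i = j := by omega
          rw [← h']
          rfl
        · have := hEb _ h
          simp [ρ] at this
  let ρ' : Config := (home :: List.replicate c one ++ [0] ++ [N], c, num ([p], false))
  have e₃ : Recur (NTM.Next M) (fun ρ => ρ.2.2 = num ([], false)) (ρ c) ↔
      Recur (NTM.Next M) (fun ρ => ρ.2.2 = num ([], false)) ρ' := by
    refine recur_iff_of_unique_step ?_ ?_
    · refine ⟨num ([p], false), 0, false, (hmem _).2 (.inr (.inl ?_)), .inr ?_, ?_⟩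
      · simp only [ρ, hget]
      · simp [ρ]
      · simp only [ρ, hset]; rfl
    · rintro _ ⟨q', b, d, he, hd, rfl⟩
      rcases (hmem _).1 he with h | h | ⟨j, hj, h⟩ | h
      · simp [ρ] at h; omega
      · simp only [ρ, hget, Prod.mk.injEq, true_and] at h
        obtain ⟨rfl, rfl, rfl⟩ := h
        simp only [ρ, hset]
        rfl
      · simp [ρ] at h; omega
      · have := hEb _ h
        simp [ρ] at this
  have hrep : Represents N Q num ρ' (([p], false), (chainTape home one c, c)) := by
    refine ⟨hp, rfl, rfl, by simp [ρ'], fun j => ?_⟩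
    have hget : ρ'.1.getD j N =
        if j = 0 then home else if j ≤ c then one else if j = c + 1 then 0 else N :=
      getD_chain ..
    rw [hget]
    simp only [chainTape, readSymbol]
    grind
  have hE' : ∀ e : (ℕ × ℕ) × (ℕ × ℕ × Bool), (∃ q ∈ Q, e.1.1 = num q) →
      (e ∈ NTM.table M ↔ ∃ q ∈ Q, ∃ q' a b d,
        CtrlStep N body q (readSymbol N a) q' b d ∧ a ≤ N ∧
          e = ((num q, a), (num q', b, d))) := by
    rintro e ⟨q, hq, he⟩
    have := hnum q hq
    rw [← hE, hmem]
    refine ⟨?_, fun h => .inr (.inr (.inr h))⟩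
    rintro (rfl | rfl | ⟨i, hi, rfl⟩ | h)
    · dsimp at he; omega
    · dsimp at he; omega
    · dsimp at he; omega
    · exact h
  show Recur (NTM.Next M) (fun ρ => ρ.2.2 = num ([], false)) (startConfig M []) ↔ _
  rw [e₂ c le_rfl, e₃]
  constructor
  · exact Recur.map (D := Represents N Q num)
      (fun _ _ _ hD hr => hD.progStep hE' hblank hinj hQ hr)
      (fun _ _ hD h => hinj hD.1 hnil (hD.2.1.symm.trans h)) hrep
  · exact Recur.map (D := fun x ρ => Represents N Q num ρ x)
      (fun _ _ _ hD hr => hD.next hE' hblank hQ hr)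
      (fun _ _ hD h => hD.2.1.trans (congrArg num h)) hrep


/-! ### Register machines on a tape -/

/-- The tape storing the registers `0, …, K - 1` of `σ` in unary on `K` parallel tracks, with the
marker `2 ^ K` on the first cell. -/
def regTape (K : ℕ) (σ : ℕ → ℕ) : ℕ → ℕ
  | 0 => 2 ^ K
  | j + 1 => Nat.ofBits fun k : Fin K => decide (j < σ k)

theorem regTape_succ_lt (K : ℕ) (σ : ℕ → ℕ) (j : ℕ) : regTape K σ (j + 1) < 2 ^ K :=
  Nat.ofBits_lt_two_pow _

theorem testBit_regTape_succ (K : ℕ) (σ : ℕ → ℕ) (j k : ℕ) :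
    (regTape K σ (j + 1)).testBit k = decide (k < K ∧ j < σ k) := by
  by_cases h : k < K
  · simp [regTape, Nat.testBit_ofBits_lt _ _ h, h]
  · simp [regTape, Nat.testBit_ofBits_ge _ _ (not_lt.1 h), h]

theorem eq_regTape_iff {K : ℕ} {σ : ℕ → ℕ} {T : ℕ → ℕ} : T = regTape K σ ↔ T 0 = 2 ^ K ∧
    ∀ j k, (T (j + 1)).testBit k = decide (k < K ∧ j < σ k) := by
  constructor
  · rintro rfl
    exact ⟨rfl, testBit_regTape_succ K σ⟩
  · rintro ⟨h0, h⟩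
    funext j
    cases j with
    | zero => exact h0
    | succ j => exact Nat.eq_of_testBit_eq fun k => by rw [h, testBit_regTape_succ]

/-- Set the bit `k < K` of `a < 2 ^ K` to `v`. -/
def setBit (K k : ℕ) (v : Bool) (a : ℕ) : ℕ :=
  Nat.ofBits fun l : Fin K => if (l : ℕ) = k then v else a.testBit l

theorem setBit_lt (K k : ℕ) (v : Bool) (a : ℕ) : setBit K k v a < 2 ^ K :=
  Nat.ofBits_lt_two_pow _

theorem testBit_setBit (K k : ℕ) (v : Bool) (a l : ℕ) :
    (setBit K k v a).testBit l = (decide (l < K) && if l = k then v else a.testBit l) := by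
  by_cases h : l < K
  · simp [setBit, Nat.testBit_ofBits_lt _ _ h, h]
  · simp [setBit, Nat.testBit_ofBits_ge _ _ (not_lt.1 h), h]

/-- Apply `F` to the current symbol if it satisfies `G`, and move the head. -/
def TapeProg.write (G : ℕ → Prop) (F : ℕ → ℕ) (d : Bool) : TapeProg :=
  .step (fun a b => G a ∧ b = F a) d

theorem TapeProg.write_sem {N : ℕ} {G : ℕ → Prop} {F : ℕ → ℕ} {d : Bool} {T : ℕ → ℕ} {p : ℕ}
    {τ' : TapeState} (hF : F (T p) < N) : (TapeProg.write G F d).Sem N (T, p) τ' ↔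
      G (T p) ∧ τ'.1 = Function.update T p (F (T p)) ∧ HeadMove d p τ'.2 := by
  constructor
  · rintro ⟨_, ⟨hG, rfl⟩, -, h⟩
    exact ⟨hG, h⟩
  · rintro ⟨hG, h⟩
    exact ⟨_, ⟨hG, rfl⟩, hF, h⟩

theorem TapeProg.write_right_sem {N : ℕ} {G : ℕ → Prop} {F : ℕ → ℕ} {T : ℕ → ℕ} {p : ℕ}
    {τ' : TapeState} (hF : F (T p) < N) : (TapeProg.write G F true).Sem N (T, p) τ' ↔
      G (T p) ∧ τ' = (Function.update T p (F (T p)), p + 1) := by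
  rw [write_sem hF, Prod.ext_iff]
  simp [HeadMove]

theorem TapeProg.write_left_sem {N : ℕ} {G : ℕ → Prop} {F : ℕ → ℕ} {T : ℕ → ℕ} {p : ℕ}
    {τ' : TapeState} (hF : F (T (p + 1)) < N) : (TapeProg.write G F false).Sem N (T, p + 1) τ' ↔
      G (T (p + 1)) ∧ τ' = (Function.update T (p + 1) (F (T (p + 1))), p) := by
  rw [write_sem hF, Prod.ext_iff]
  simp [HeadMove, eq_comm]

/-- Move the head to the marker. -/
def TapeProg.rewind (K : ℕ) : TapeProg :=
  .seq (.star (.write (· ≠ 2 ^ K) id false))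
    (.seq (.write (· = 2 ^ K) id true) (.write (fun _ => True) id false))

theorem TapeProg.rewind_sem {K : ℕ} {T : ℕ → ℕ} {p : ℕ} {τ' : TapeState} (h0 : T 0 = 2 ^ K)
    (h : ∀ j, T (j + 1) < 2 ^ K) :
    (TapeProg.rewind K).Sem (2 ^ K + 1) (T, p) τ' ↔ τ' = (T, 0) := by
  have hT : ∀ j, T j < 2 ^ K + 1 := fun j => by
    cases j with
    | zero => omega
    | succ j => have := h j; omega
  have hfin : ∀ q, ((TapeProg.seq (.write (· = 2 ^ K) id true)
      (.write (fun _ => True) id false)).Sem (2 ^ K + 1) (T, q) τ' ↔ q = 0 ∧ τ' = (T, 0)) := by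
    intro q
    constructor
    · rintro ⟨τ, h₁, h₂⟩
      obtain ⟨hq, rfl⟩ := (write_right_sem (hT q)).1 h₁
      rw [id, Function.update_eq_self] at h₂
      obtain ⟨-, rfl⟩ := (write_left_sem (F := id) (T := T) (hT (q + 1))).1 h₂
      rw [id, Function.update_eq_self]
      cases q with
      | zero => exact ⟨rfl, rfl⟩
      | succ q => exact absurd hq (h q).ne
    · rintro ⟨rfl, rfl⟩
      refine ⟨(T, 1), (write_right_sem (hT 0)).2 ⟨h0, ?_⟩, (write_left_sem (hT 1)).2 ⟨trivial, ?_⟩⟩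
      · rw [id, Function.update_eq_self]
      · rw [id, Function.update_eq_self]
  constructor
  · rintro ⟨τ, h₁, h₂⟩
    have : τ.1 = T := by
      clear h₂
      induction h₁ with
      | refl => rfl
      | @tail x _ _ hxy ih =>
        obtain ⟨_, q⟩ := x
        obtain rfl : _ = T := ih
        obtain ⟨-, hy, -⟩ := (write_sem (hT q)).1 hxy
        rw [hy, id, Function.update_eq_self]
    obtain ⟨_, q⟩ := τ
    subst this
    exact ((hfin q).1 h₂).2
  · rintro rfl
    refine ⟨(T, 0), ?_, (hfin 0).2 ⟨rfl, rfl⟩⟩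
    induction p with
    | zero => exact .refl
    | succ p ih =>
      refine .head ((write_left_sem (F := id) (T := T) (hT (p + 1))).2 ⟨(h p).ne, ?_⟩) ih
      rw [id, Function.update_eq_self]

theorem TapeProg.star_write_right_sem {N : ℕ} {G : ℕ → Prop} {F : ℕ → ℕ} {T : ℕ → ℕ} {p : ℕ}
    {τ' : TapeState} (hF : ∀ j, F (T j) < N) :
    (TapeProg.star (.write G F true)).Sem N (T, p) τ' ↔ ∃ n, (∀ j < n, G (T (p + j))) ∧
      τ' = (fun x => if p ≤ x ∧ x < p + n then F (T x) else T x, p + n) := by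
  have key : ∀ n, (∀ j < n, G (T (p + j))) → ∀ τ, (TapeProg.write G F true).Sem N
      (fun x => if p ≤ x ∧ x < p + n then F (T x) else T x, p + n) τ ↔
      G (T (p + n)) ∧ τ = (fun x => if p ≤ x ∧ x < p + (n + 1) then F (T x) else T x,
        p + (n + 1)) := by
    intro n _ τ
    rw [write_right_sem (by simpa using hF _)]
    have : Function.update (fun x => if p ≤ x ∧ x < p + n then F (T x) else T x) (p + n)
        (F (T (p + n))) = fun x => if p ≤ x ∧ x < p + (n + 1) then F (T x) else T x := by
      funext x
      rcases eq_or_ne x (p + n) with rfl | hx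
      · simp
      · rw [Function.update_of_ne hx]
        congr 1
        simp only [eq_iff_iff]
        omega
    simp only [lt_irrefl, and_false, if_false, this]
    rfl
  constructor
  · intro h
    induction h with
    | refl => exact ⟨0, by simp, Prod.ext (funext fun x => (if_neg (by omega)).symm) rfl⟩
    | tail _ h ih =>
      obtain ⟨n, hG, rfl⟩ := ih
      obtain ⟨hn, rfl⟩ := (key n hG _).1 h
      exact ⟨n + 1, fun j hj => (Nat.lt_succ_iff_lt_or_eq.1 hj).elim (hG j) (· ▸ hn), rfl⟩
  · rintro ⟨n, hG, rfl⟩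
    induction n with
    | zero =>
      rw [show (fun x => if p ≤ x ∧ x < p + 0 then F (T x) else T x) = T from
        funext fun x => if_neg (by omega)]
      exact .refl
    | succ n ih =>
      exact .tail (ih fun j hj => hG j (by omega))
        ((key n (fun j hj => hG j (by omega)) _).2 ⟨hG n (by omega), rfl⟩)

/-- Scan to the right from the first cell after the marker, then modify the current cell and the
one before, and return to the marker. -/
def TapeProg.scan (K : ℕ) (G : ℕ → Prop) (F : ℕ → ℕ) (G₁ : ℕ → Prop) (F₁ : ℕ → ℕ)
    (G₂ : ℕ → Prop) (F₂ : ℕ → ℕ) : TapeProg :=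
  .seq (.write (· = 2 ^ K) id true) (.seq (.star (.write G F true))
    (.seq (.write G₁ F₁ false) (.seq (.write G₂ F₂ true) (.rewind K))))

/-- On the registers `σ`, the guards of `TapeProg.scan` allow to scan `n` cells. -/
def ScanGuard (K : ℕ) (G : ℕ → Prop) (F : ℕ → ℕ) (G₁ G₂ : ℕ → Prop) (σ : ℕ → ℕ) (n : ℕ) : Prop :=
  (∀ j < n, G (regTape K σ (j + 1))) ∧ G₁ (regTape K σ (n + 1)) ∧
    G₂ (if n = 0 then 2 ^ K else F (regTape K σ n))

/-- The tape after `TapeProg.scan` with `n` scanned cells. -/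
def scanTape (K : ℕ) (F F₁ F₂ : ℕ → ℕ) (σ : ℕ → ℕ) (n : ℕ) : ℕ → ℕ
  | 0 => if n = 0 then F₂ (2 ^ K) else 2 ^ K
  | j + 1 => if j + 1 < n then F (regTape K σ (j + 1)) else
      if j + 1 = n then F₂ (F (regTape K σ (j + 1))) else
      if j = n then F₁ (regTape K σ (j + 1)) else regTape K σ (j + 1)

theorem TapeProg.scan_sem {K : ℕ} {G G₁ G₂ : ℕ → Prop} {F F₁ F₂ : ℕ → ℕ}
    (hF : ∀ a, a ≤ 2 ^ K → F a ≤ 2 ^ K) (hF₁ : ∀ a, a ≤ 2 ^ K → F₁ a ≤ 2 ^ K)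
    (hF₂ : ∀ a, a ≤ 2 ^ K → F₂ a ≤ 2 ^ K) {σ : ℕ → ℕ} {τ' : TapeState} :
    (TapeProg.scan K G F G₁ F₁ G₂ F₂).Sem (2 ^ K + 1) (regTape K σ, 0) τ' ↔
      ∃ n, ScanGuard K G F G₁ G₂ σ n ∧
        (TapeProg.rewind K).Sem (2 ^ K + 1) (scanTape K F F₁ F₂ σ n, n + 1) τ' := by
  have hT : ∀ j, regTape K σ j ≤ 2 ^ K := fun j => by
    cases j with
    | zero => exact le_rfl
    | succ j => exact (regTape_succ_lt K σ j).le
  have hFT : ∀ j, F (regTape K σ j) < 2 ^ K + 1 := fun j => Nat.lt_succ_of_le (hF _ (hT j))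
  let T₁ : ℕ → ℕ → ℕ := fun n x => if 1 ≤ x ∧ x < n + 1 then F (regTape K σ x) else regTape K σ x
  have hT₁ : ∀ n x, T₁ n x ≤ 2 ^ K := fun n x => by
    simp only [T₁]
    split_ifs
    exacts [hF _ (hT x), hT x]
  let T₂ : ℕ → ℕ → ℕ := fun n => Function.update (T₁ n) (n + 1) (F₁ (T₁ n (n + 1)))
  have hT₂ : ∀ n x, T₂ n x ≤ 2 ^ K := fun n x => by
    simp only [T₂]
    rcases eq_or_ne x (n + 1) with rfl | hx
    · simpa using hF₁ _ (hT₁ _ _)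
    · simpa [hx] using hT₁ n x
  let T₃ : ℕ → ℕ → ℕ := fun n => Function.update (T₂ n) n (F₂ (T₂ n n))
  have e₁ : ∀ n, T₁ n (n + 1) = regTape K σ (n + 1) := fun n => if_neg (by omega)
  have e₂ : ∀ n, T₂ n n = if n = 0 then 2 ^ K else F (regTape K σ n) := fun n => by
    cases n <;> simp [T₂, T₁, regTape]
  have e₃ : ∀ n, T₃ n = scanTape K F F₁ F₂ σ n := by
    intro n
    funext j
    rcases j with _ | j
    · cases n <;> simp [T₃, T₂, T₁, regTape, scanTape]
    simp only [T₃, Function.update_apply, e₂, scanTape]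
    rcases lt_trichotomy (j + 1) n with h | h | h
    · simp [T₂, T₁, h, h.ne, show j ≠ n by omega]
      omega
    · simp [h, show n ≠ 0 by omega]
    · rw [if_neg h.ne', if_neg (by omega), if_neg h.ne']
      simp only [T₂, Function.update_apply, e₁, Nat.add_right_cancel_iff]
      split_ifs with h'
      · rw [h']
      · exact if_neg (by omega)
  constructor
  · rintro ⟨_, h₁, _, h₂, _, h₃, _, h₄, h₅⟩
    obtain ⟨-, rfl⟩ := (write_right_sem (Nat.lt_succ_of_le (hT 0))).1 h₁
    rw [id, Function.update_eq_self] at h₂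
    obtain ⟨n, hG, rfl⟩ := (star_write_right_sem hFT).1 h₂
    rw [show 0 + 1 + n = n + 1 from by omega] at h₃
    obtain ⟨hG₁, rfl⟩ := (write_left_sem (F := F₁) (T := T₁ n)
      (Nat.lt_succ_of_le (hF₁ _ (hT₁ n (n + 1))))).1 h₃
    obtain ⟨hG₂, rfl⟩ := (write_right_sem (F := F₂) (T := T₂ n)
      (Nat.lt_succ_of_le (hF₂ _ (hT₂ n n)))).1 h₄
    refine ⟨n, ⟨fun j hj => ?_, e₁ n ▸ hG₁, e₂ n ▸ hG₂⟩, e₃ n ▸ h₅⟩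
    have := hG j hj
    rwa [show 0 + 1 + j = j + 1 by omega] at this
  · rintro ⟨n, ⟨hG, hG₁, hG₂⟩, hr⟩
    refine ⟨_, (write_right_sem (Nat.lt_succ_of_le (hT 0))).2 ⟨rfl, rfl⟩, (T₁ n, n + 1), ?_,
      (T₂ n, n), ?_, (T₃ n, n + 1), ?_, e₃ n ▸ hr⟩
    · rw [id, Function.update_eq_self]
      refine (star_write_right_sem hFT).2 ⟨n, fun j hj => ?_, ?_⟩
      · rw [show 0 + 1 + j = j + 1 by omega]
        exact hG j hj
      · rw [show 0 + 1 + n = n + 1 by omega]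
    · exact (write_left_sem (Nat.lt_succ_of_le (hF₁ _ (hT₁ n (n + 1))))).2 ⟨(e₁ n).symm ▸ hG₁, rfl⟩
    · exact (write_right_sem (Nat.lt_succ_of_le (hF₂ _ (hT₂ n n)))).2 ⟨(e₂ n).symm ▸ hG₂, rfl⟩

theorem TapeProg.rewind_regTape_sem {K : ℕ} {σ : ℕ → ℕ} {p : ℕ} {τ' : TapeState} :
    (TapeProg.rewind K).Sem (2 ^ K + 1) (regTape K σ, p) τ' ↔ τ' = (regTape K σ, 0) :=
  rewind_sem rfl (regTape_succ_lt K σ)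

/-- The register relation `S` is computed by tape programs with sufficiently many tracks. -/
def Realizable (S : (ℕ → ℕ) → (ℕ → ℕ) → Prop) : Prop :=
  ∀ᶠ K in Filter.atTop, ∃ P : TapeProg, ∀ σ τ', P.Sem (2 ^ K + 1) (regTape K σ, 0) τ' ↔
    ∃ σ', S σ σ' ∧ τ' = (regTape K σ', 0)

theorem Realizable.comp {S S' : (ℕ → ℕ) → (ℕ → ℕ) → Prop} (h : Realizable S)
    (h' : Realizable S') : Realizable (Relation.Comp S S') := by
  filter_upwards [h, h'] with K ⟨P, hP⟩ ⟨P', hP'⟩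
  refine ⟨.seq P P', fun σ τ' => ?_⟩
  constructor
  · rintro ⟨τ, h₁, h₂⟩
    obtain ⟨σ₁, hσ₁, rfl⟩ := (hP _ _).1 h₁
    obtain ⟨σ₂, hσ₂, rfl⟩ := (hP' _ _).1 h₂
    exact ⟨σ₂, ⟨σ₁, hσ₁, hσ₂⟩, rfl⟩
  · rintro ⟨σ₂, ⟨σ₁, hσ₁, hσ₂⟩, rfl⟩
    exact ⟨_, (hP _ _).2 ⟨σ₁, hσ₁, rfl⟩, (hP' _ _).2 ⟨σ₂, hσ₂, rfl⟩⟩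

theorem Realizable.star {S : (ℕ → ℕ) → (ℕ → ℕ) → Prop} (h : Realizable S) :
    Realizable (Relation.ReflTransGen S) := by
  filter_upwards [h] with K ⟨P, hP⟩
  refine ⟨.star P, fun σ τ' => ?_⟩
  constructor
  · intro h
    induction h with
    | refl => exact ⟨σ, .refl, rfl⟩
    | tail _ h ih =>
      obtain ⟨σ₁, hσ₁, rfl⟩ := ih
      obtain ⟨σ₂, hσ₂, rfl⟩ := (hP _ _).1 h
      exact ⟨σ₂, hσ₁.tail hσ₂, rfl⟩
  · rintro ⟨σ', h, rfl⟩
    exact h.lift (fun σ => (regTape K σ, 0)) fun σ₁ σ₂ h => (hP _ _).2 ⟨σ₂, h, rfl⟩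

theorem realizable_of_scan {C : (ℕ → ℕ) → Prop} {f : (ℕ → ℕ) → ℕ → ℕ} (m : ℕ)
    {G G₁ G₂ : ℕ → ℕ → Prop} {F F₁ F₂ : ℕ → ℕ → ℕ}
    (hF : ∀ K a, a ≤ 2 ^ K → F K a ≤ 2 ^ K) (hF₁ : ∀ K a, a ≤ 2 ^ K → F₁ K a ≤ 2 ^ K)
    (hF₂ : ∀ K a, a ≤ 2 ^ K → F₂ K a ≤ 2 ^ K)
    (h : ∀ K, m < K → ∀ σ,
      (∀ n, ScanGuard K (G K) (F K) (G₁ K) (G₂ K) σ n →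
        C σ ∧ scanTape K (F K) (F₁ K) (F₂ K) σ n = regTape K (f σ)) ∧
      (C σ → ∃ n, ScanGuard K (G K) (F K) (G₁ K) (G₂ K) σ n)) :
    Realizable fun σ σ' => C σ ∧ σ' = f σ := by
  filter_upwards [Filter.eventually_gt_atTop m] with K hK
  refine ⟨.scan K (G K) (F K) (G₁ K) (F₁ K) (G₂ K) (F₂ K), fun σ τ' => ?_⟩
  obtain ⟨h₁, h₂⟩ := h K hK σ
  rw [TapeProg.scan_sem (hF K) (hF₁ K) (hF₂ K)]
  constructor
  · rintro ⟨n, hs, hr⟩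
    obtain ⟨hC, hT⟩ := h₁ n hs
    rw [hT] at hr
    exact ⟨_, ⟨hC, rfl⟩, TapeProg.rewind_regTape_sem.1 hr⟩
  · rintro ⟨_, ⟨hC, rfl⟩, rfl⟩
    obtain ⟨n, hs⟩ := h₂ hC
    refine ⟨n, hs, ?_⟩
    rw [(h₁ n hs).2]
    exact TapeProg.rewind_regTape_sem.2 rfl

theorem realizable_inc (i : ℕ) :
    Realizable fun σ σ' => σ' = Function.update σ i (σ i + 1) := by
  have key : Realizable fun σ σ' => True ∧ σ' = Function.update σ i (σ i + 1) := by
    refine realizable_of_scan i (G := fun _ a => a.testBit i) (F := fun _ a => a)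
      (G₁ := fun _ a => ¬ a.testBit i) (F₁ := fun K => setBit K i true) (G₂ := fun _ _ => True)
      (F₂ := fun _ a => a) (fun _ _ h => h) (fun _ _ _ => (setBit_lt ..).le) (fun _ _ h => h)
      fun K hK σ => ⟨?_, fun _ => ⟨σ i, ?_⟩⟩
    · rintro n ⟨h₁, h₂, -⟩
      simp only [testBit_regTape_succ, decide_eq_true_iff] at h₁ h₂
      obtain rfl : n = σ i := by have := h₁ (σ i); omega
      refine ⟨trivial, eq_regTape_iff.2 ⟨by simp [scanTape], fun j k => ?_⟩⟩
      simp only [scanTape]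
      split_ifs <;> simp only [testBit_setBit, testBit_regTape_succ, Function.update_apply] <;> grind
    · simp [ScanGuard, testBit_regTape_succ, hK]
  simpa only [true_and] using key

theorem realizable_dec (i : ℕ) :
    Realizable fun σ σ' => 0 < σ i ∧ σ' = Function.update σ i (σ i - 1) := by
  refine realizable_of_scan i (G := fun _ a => a.testBit i) (F := fun _ a => a)
    (G₁ := fun _ a => ¬ a.testBit i) (F₁ := fun _ a => a) (G₂ := fun K a => a ≠ 2 ^ K)
    (F₂ := fun K => setBit K i false) (fun _ _ h => h) (fun _ _ h => h)
    (fun _ _ _ => (setBit_lt ..).le) fun K hK σ => ⟨?_, fun h => ⟨σ i, ?_⟩⟩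
  · rintro n ⟨h₁, h₂, h₃⟩
    simp only [testBit_regTape_succ, decide_eq_true_iff] at h₁ h₂
    obtain rfl : n = σ i := by have := h₁ (σ i); omega
    have hpos : 0 < σ i := by grind
    refine ⟨hpos, eq_regTape_iff.2 ⟨by simp [scanTape, hpos.ne'], fun j k => ?_⟩⟩
    simp only [scanTape]
    split_ifs <;> simp only [testBit_setBit, testBit_regTape_succ, Function.update_apply] <;> grind
  · obtain ⟨n, hn⟩ := Nat.exists_eq_succ_of_ne_zero h.ne'
    simp [ScanGuard, testBit_regTape_succ, hK, hn, (regTape_succ_lt K σ n).ne]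

theorem realizable_zero (i : ℕ) : Realizable fun σ σ' => σ i = 0 ∧ σ' = σ := by
  refine realizable_of_scan (f := id) i (G := fun _ _ => False) (F := fun _ a => a)
    (G₁ := fun _ a => ¬ a.testBit i) (F₁ := fun _ a => a) (G₂ := fun _ _ => True)
    (F₂ := fun _ a => a) (fun _ _ h => h) (fun _ _ h => h) (fun _ _ h => h)
    fun K hK σ => ⟨?_, fun h => ⟨0, ?_⟩⟩
  · rintro n ⟨h₁, h₂, -⟩
    obtain rfl : n = 0 := Nat.eq_zero_of_not_pos fun h => h₁ 0 h
    simp only [testBit_regTape_succ, decide_eq_true_iff] at h₂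
    refine ⟨by omega, funext fun j => ?_⟩
    cases j <;> simp [scanTape, regTape]
  · simp [ScanGuard, testBit_regTape_succ, h]

theorem realizable_copy (i j : ℕ) :
    Realizable fun σ σ' => σ' = Function.update σ j (σ i) := by
  have key : Realizable fun σ σ' => True ∧ σ' = Function.update σ j (σ i) := by
    refine realizable_of_scan (max i j) (G := fun _ _ => True)
      (F := fun K a => setBit K j (a.testBit i) a)
      (G₁ := fun _ a => ¬ a.testBit i ∧ ¬ a.testBit j) (F₁ := fun _ a => a) (G₂ := fun _ _ => True)
      (F₂ := fun _ a => a) (fun _ _ _ => (setBit_lt ..).le) (fun _ _ h => h) (fun _ _ h => h)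
      fun K hK σ => ⟨?_, fun _ => ⟨max (σ i) (σ j), ?_⟩⟩
    · rintro n ⟨-, h₂, -⟩
      simp only [testBit_regTape_succ, decide_eq_true_iff] at h₂
      refine ⟨trivial, eq_regTape_iff.2 ⟨by simp [scanTape], fun j k => ?_⟩⟩
      simp only [scanTape, ite_self]
      split_ifs <;> simp only [testBit_setBit, testBit_regTape_succ, Function.update_apply] <;> grind
    · simp [ScanGuard, testBit_regTape_succ]
  simpa only [true_and] using key


open List.Vector (ofFn)

/-! ### Computing partial recursive functions with registers -/

theorem realizable_clear (i : ℕ) : Realizable fun σ σ' => σ' = Function.update σ i 0 := by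
  have h := (realizable_dec i).star.comp (realizable_zero i)
  convert h using 3 with σ σ'
  constructor
  · intro h
    refine ⟨σ', ?_, by simp [h], rfl⟩
    obtain ⟨k, hk⟩ : ∃ k, σ i = k := ⟨_, rfl⟩
    induction k generalizing σ with
    | zero =>
      rw [← hk, Function.update_eq_self] at h
      rw [h]
    | succ k ih =>
      refine .head ⟨by omega, rfl⟩ (ih (σ := Function.update σ i (σ i - 1)) ?_ ?_)
      · simpa using h
      · simp [hk]
  · rintro ⟨σ₁, h, h0, rfl⟩
    have key : ∀ {τ}, Relation.ReflTransGen
        (fun σ σ' => 0 < σ i ∧ σ' = Function.update σ i (σ i - 1)) σ τ →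
        Function.update τ i 0 = Function.update σ i 0 := fun h => by
      induction h with
      | refl => rfl
      | tail _ h ih => rw [h.2, Function.update_idem, ih]
    rw [← key h, ← h0, Function.update_eq_self]

/-- `S` leaves the registers below `b` unchanged and computes `f`, applied to the registers `r`,
into the register `b`. -/
def Implements {n : ℕ} (S : (ℕ → ℕ) → (ℕ → ℕ) → Prop) (r : Fin n → ℕ) (b : ℕ)
    (f : List.Vector ℕ n →. ℕ) : Prop :=
  ∀ σ, (∀ σ', S σ σ' → (∀ i < b, σ' i = σ i) ∧ σ' b ∈ f (ofFn (σ ∘ r))) ∧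
    ∀ y ∈ f (ofFn (σ ∘ r)), ∃ σ', S σ σ'

/-- `f` can be computed from arbitrary registers below `b` into the register `b`, using the
registers above as scratch space. -/
def RegComputable {n : ℕ} (f : List.Vector ℕ n →. ℕ) : Prop :=
  ∀ (r : Fin n → ℕ) (b : ℕ), (∀ i, r i < b) → ∃ S, Realizable S ∧ Implements S r b f

theorem RegComputable.of_eq {n : ℕ} {f g : List.Vector ℕ n →. ℕ} (hf : RegComputable f)
    (h : ∀ v, f v = g v) : RegComputable g :=
  (funext h : f = g) ▸ hf

theorem comp_congr_below {n b : ℕ} {r : Fin n → ℕ} (hr : ∀ i, r i < b) {σ σ' : ℕ → ℕ}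
    (h : ∀ i < b, σ' i = σ i) : σ' ∘ r = σ ∘ r :=
  funext fun i => h _ (hr i)

theorem RegComputable.exists_tuple {m n : ℕ} {g : Fin m → List.Vector ℕ n →. ℕ}
    (hg : ∀ i, RegComputable (g i)) {r : Fin n → ℕ} {b : ℕ} (hr : ∀ i, r i < b) (k : ℕ)
    (hk : k ≤ m) : ∃ S, Realizable S ∧ ∀ σ,
      (∀ σ', S σ σ' → (∀ i < b, σ' i = σ i) ∧
        ∀ i : Fin m, i < k → σ' (b + i) ∈ g i (ofFn (σ ∘ r))) ∧
      ((∀ i, ∃ y, y ∈ g i (ofFn (σ ∘ r))) → ∃ σ', S σ σ') := by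
  induction k with
  | zero =>
    refine ⟨_, realizable_clear b, fun σ => ⟨?_, fun _ => ⟨_, rfl⟩⟩⟩
    rintro _ rfl
    exact ⟨fun i hi => by simp [hi.ne], by simp⟩
  | succ k ih =>
    obtain ⟨S, hS, h⟩ := ih (by omega)
    obtain ⟨S', hS', h'⟩ := hg ⟨k, hk⟩ r (b + k) (fun i => Nat.lt_add_right k (hr i))
    refine ⟨_, hS.comp hS', fun σ => ⟨?_, fun hy => ?_⟩⟩
    · rintro σ₂ ⟨σ₁, h₁, h₂⟩
      obtain ⟨hb, hg₁⟩ := (h σ).1 _ h₁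
      obtain ⟨hb', hg₂⟩ := (h' σ₁).1 _ h₂
      refine ⟨fun i hi => (hb' i (by omega)).trans (hb i hi), fun i hi => ?_⟩
      rcases Nat.lt_succ_iff_lt_or_eq.1 hi with hi | hi
      · rw [hb' _ (by omega)]
        exact hg₁ i hi
      · obtain rfl : i = ⟨k, hk⟩ := Fin.ext hi
        rwa [comp_congr_below hr hb] at hg₂
    · obtain ⟨σ₁, h₁⟩ := (h σ).2 hy
      obtain ⟨y, hy⟩ := hy ⟨k, hk⟩
      obtain ⟨σ₂, h₂⟩ := (h' σ₁).2 y (by rwa [comp_congr_below hr ((h σ).1 _ h₁).1])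
      exact ⟨σ₂, σ₁, h₁, h₂⟩

theorem mem_mOfFn {α : Type*} : ∀ {n : ℕ} {x : Fin n → Part α} {w : List.Vector α n},
    w ∈ List.Vector.mOfFn x ↔ ∀ i, w.get i ∈ x i
  | 0, x, w => by
    simp [List.Vector.mOfFn, pure, Part.mem_some_iff, eq_iff_true_of_subsingleton]
  | n + 1, x, w => by
    simp only [List.Vector.mOfFn, bind, pure, Part.mem_bind_iff, Part.mem_some_iff, mem_mOfFn,
      Fin.forall_fin_succ]
    constructor
    · rintro ⟨a, ha, v, hv, rfl⟩
      exact ⟨by simpa using ha, by simpa using hv⟩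
    · rintro ⟨h0, h⟩
      exact ⟨_, h0, w.tail, by simpa using h, by simp⟩

theorem RegComputable.comp {m n : ℕ} {f : List.Vector ℕ m →. ℕ}
    {g : Fin m → List.Vector ℕ n →. ℕ} (hf : RegComputable f) (hg : ∀ i, RegComputable (g i)) :
    RegComputable fun v => (List.Vector.mOfFn fun i => g i v) >>= f := by
  intro r b hr
  obtain ⟨S, hS, h⟩ := exists_tuple hg hr m le_rfl
  obtain ⟨S', hS', h'⟩ := hf (fun i => b + i) (b + m) (fun i => by omega)
  refine ⟨_, hS.comp (hS'.comp (realizable_copy (b + m) b)), fun σ => ⟨?_, ?_⟩⟩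
  · rintro _ ⟨σ₁, h₁, σ₂, h₂, rfl⟩
    obtain ⟨hb, hg₁⟩ := (h σ).1 _ h₁
    obtain ⟨hb', hy⟩ := (h' σ₁).1 _ h₂
    refine ⟨fun i hi => ?_, ?_⟩
    · rw [Function.update_of_ne hi.ne, hb' i (by omega), hb i hi]
    · rw [Function.update_self]
      refine Part.mem_bind_iff.2 ⟨_, mem_mOfFn.2 fun i => ?_, hy⟩
      simpa using hg₁ i i.2
  · intro y hy
    obtain ⟨w, hw, hy⟩ := Part.mem_bind_iff.1 hy
    rw [mem_mOfFn] at hw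
    obtain ⟨σ₁, h₁⟩ := (h σ).2 fun i => ⟨_, hw i⟩
    have : ofFn (σ₁ ∘ fun i : Fin m => b + (i : ℕ)) = w := by
      refine List.Vector.ext fun i => ?_
      rw [List.Vector.get_ofFn]
      exact Part.mem_unique (((h σ).1 _ h₁).2 i i.2) (hw i)
    obtain ⟨σ₂, h₂⟩ := (h' σ₁).2 y (by rwa [this])
    exact ⟨_, σ₁, h₁, σ₂, h₂, rfl⟩

theorem RegComputable.rfind {n : ℕ} {f : List.Vector ℕ (n + 1) → ℕ}
    (hf : RegComputable (f : List.Vector ℕ (n + 1) →. ℕ)) :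
    RegComputable fun v => Nat.rfind fun k => Part.some (decide (f (k ::ᵥ v) = 0)) := by
  intro r b hr
  have hr' : ∀ i, (Fin.cons b r : Fin (n + 1) → ℕ) i < b + 1 :=
    Fin.cases (by simp) fun i => (by simpa using (hr i).le)
  obtain ⟨S, hS, h⟩ := hf (Fin.cons b r) (b + 1) hr'
  have hcons : ∀ σ : ℕ → ℕ, ofFn (σ ∘ (Fin.cons b r : Fin (n + 1) → ℕ)) =
    σ b ::ᵥ ofFn (σ ∘ r) := fun _ => rfl
  simp only [Implements, hcons, PFun.coe_val, Part.mem_some_iff, forall_eq] at h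
  let B : (ℕ → ℕ) → (ℕ → ℕ) → Prop := Relation.Comp S (Relation.Comp
    (fun σ σ' => 0 < σ (b + 1) ∧ σ' = Function.update σ (b + 1) (σ (b + 1) - 1))
    (fun σ σ' => σ' = Function.update σ b (σ b + 1)))
  have hbody : Realizable B := hS.comp ((realizable_dec (b + 1)).comp (realizable_inc b))
  refine ⟨_, (realizable_clear b).comp (hbody.star.comp (hS.comp (realizable_zero (b + 1)))),
    fun σ => ?_⟩
  have hmem : ∀ y, (y ∈ Nat.rfind fun k => Part.some (decide (f (k ::ᵥ ofFn (σ ∘ r)) = 0))) ↔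
      f (y ::ᵥ ofFn (σ ∘ r)) = 0 ∧ ∀ m < y, f (m ::ᵥ ofFn (σ ∘ r)) ≠ 0 :=
    fun y => Nat.mem_rfind.trans (by simp)
  beta_reduce
  simp only [hmem]
  constructor
  · rintro σ₃ ⟨_, rfl, σ₂, h₂, σ₃', h₃, h0, rfl⟩
    have inv : (∀ i < b, σ₂ i = σ i) ∧ ∀ k < σ₂ b, f (k ::ᵥ ofFn (σ ∘ r)) ≠ 0 := by
      clear h₃
      induction h₂ with
      | refl => exact ⟨fun i hi => by simp [hi.ne], by simp⟩
      | @tail τ _ _ hτ ih =>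
        obtain ⟨τ₁, h₁, _, ⟨hpos, rfl⟩, rfl⟩ := hτ
        obtain ⟨hb, hy⟩ := (h τ).1 _ h₁
        refine ⟨fun i hi => ?_, fun k hk => ?_⟩
        · rw [Function.update_of_ne hi.ne, Function.update_of_ne (by omega), hb i (by omega),
            ih.1 i hi]
        · have hk : k < τ b + 1 := by simpa [hb b] using hk
          rcases Nat.lt_succ_iff_lt_or_eq.1 hk with hk | rfl
          · exact ih.2 k hk
          · rw [← comp_congr_below hr ih.1, ← hy]
            exact hpos.ne'
    obtain ⟨hb, hy⟩ := (h σ₂).1 _ h₃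
    refine ⟨fun i hi => (hb i (by omega)).trans (inv.1 i hi), ?_, fun k hk => ?_⟩
    · rw [hb b (by omega), ← comp_congr_below hr inv.1, ← hy, h0]
    · exact inv.2 k (hb b (by omega) ▸ hk)
  · rintro y ⟨hy, hlt⟩
    have reach : ∀ k ≤ y, ∃ τ, Relation.ReflTransGen B (Function.update σ b 0) τ ∧
        (∀ i < b, τ i = σ i) ∧ τ b = k := by
      intro k
      induction k with
      | zero => exact fun _ => ⟨_, .refl, fun i hi => by simp [hi.ne], by simp⟩
      | succ k ih =>
        intro hk
        obtain ⟨τ, hτ, hb, hτb⟩ := ih (by omega)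
        obtain ⟨τ₁, h₁⟩ := (h τ).2
        obtain ⟨hb₁, hy₁⟩ := (h τ).1 _ h₁
        rw [hτb, comp_congr_below hr hb] at hy₁
        refine ⟨_, hτ.tail ⟨τ₁, h₁, _, ⟨?_, rfl⟩, rfl⟩, fun i hi => ?_, ?_⟩
        · have := hlt k (by omega)
          omega
        · rw [Function.update_of_ne hi.ne, Function.update_of_ne (by omega), hb₁ i (by omega),
            hb i hi]
        · simp [hb₁ b, hτb]
    obtain ⟨τ, hτ, hb, rfl⟩ := reach y le_rfl
    obtain ⟨τ₁, h₁⟩ := (h τ).2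
    refine ⟨τ₁, _, rfl, τ, hτ, τ₁, h₁, ?_, rfl⟩
    rw [((h τ).1 _ h₁).2, comp_congr_below hr hb, hy]

theorem RegComputable.prec {n : ℕ} {f : List.Vector ℕ n → ℕ} {g : List.Vector ℕ (n + 2) → ℕ}
    (hf : RegComputable (f : List.Vector ℕ n →. ℕ))
    (hg : RegComputable (g : List.Vector ℕ (n + 2) →. ℕ)) :
    RegComputable ((fun v => v.head.rec (f v.tail) fun y IH => g (y ::ᵥ IH ::ᵥ v.tail) :
      List.Vector ℕ (n + 1) → ℕ) : List.Vector ℕ (n + 1) →. ℕ) := by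
  intro r b hr
  have hrs : ∀ i, (r ∘ Fin.succ) i < b := fun i => hr _
  obtain ⟨S, hS, h⟩ := hf (r ∘ Fin.succ) b hrs
  obtain ⟨S', hS', h'⟩ := hg (Fin.cons (b + 1) (Fin.cons b (r ∘ Fin.succ))) (b + 3)
    (Fin.cases (by simp) <| Fin.cases (by simp) fun i => (by have := hrs i; simp at this ⊢; omega))
  have hcons : ∀ σ : ℕ → ℕ, ofFn (σ ∘ (Fin.cons (b + 1) (Fin.cons b (r ∘ Fin.succ)) :
    Fin (n + 2) → ℕ)) = σ (b + 1) ::ᵥ σ b ::ᵥ ofFn (σ ∘ (r ∘ Fin.succ)) := fun _ => rfl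
  have hhead : ∀ σ : ℕ → ℕ, (ofFn (σ ∘ r)).head = σ (r 0) := fun _ => rfl
  have htail : ∀ σ : ℕ → ℕ, (ofFn (σ ∘ r)).tail = ofFn (σ ∘ (r ∘ Fin.succ)) := fun _ => rfl
  simp only [Implements, hcons, PFun.coe_val, Part.mem_some_iff, forall_eq] at h h'
  let B : (ℕ → ℕ) → (ℕ → ℕ) → Prop := Relation.Comp
    (fun σ σ' => 0 < σ (b + 2) ∧ σ' = Function.update σ (b + 2) (σ (b + 2) - 1))
    (Relation.Comp S' (Relation.Comp (fun σ σ' => σ' = Function.update σ b (σ (b + 3)))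
      (fun σ σ' => σ' = Function.update σ (b + 1) (σ (b + 1) + 1))))
  have hbody : Realizable B := (realizable_dec (b + 2)).comp (hS'.comp
    ((realizable_copy (b + 3) b).comp (realizable_inc (b + 1))))
  refine ⟨_, hS.comp ((realizable_clear (b + 1)).comp ((realizable_copy (r 0) (b + 2)).comp
    (hbody.star.comp (realizable_zero (b + 2))))), fun σ => ?_⟩
  simp only [PFun.coe_val, Part.mem_some_iff, forall_eq, hhead, htail]
  let F : ℕ → ℕ := fun k => k.rec (f (ofFn (σ ∘ (r ∘ Fin.succ))))
    fun y IH => g (y ::ᵥ IH ::ᵥ ofFn (σ ∘ (r ∘ Fin.succ)))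
  let Inv : (ℕ → ℕ) → Prop := fun τ =>
    (∀ i < b, τ i = σ i) ∧ τ b = F (τ (b + 1)) ∧ τ (b + 1) + τ (b + 2) = σ (r 0)
  have hinit : ∀ σ₁, S σ σ₁ → Inv (Function.update (Function.update σ₁ (b + 1) 0) (b + 2)
      (Function.update σ₁ (b + 1) 0 (r 0))) := by
    intro σ₁ h₁
    obtain ⟨hb, hy⟩ := (h σ).1 _ h₁
    have := hr 0
    refine ⟨fun i hi => ?_, ?_, ?_⟩
    · rw [Function.update_of_ne (by omega), Function.update_of_ne (by omega), hb i hi]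
    · simpa [F] using hy
    · simp [show r 0 ≠ b + 1 by omega, hb _ this]
  have hstep : ∀ τ τ', Inv τ → B τ τ' → Inv τ' ∧ τ' (b + 2) + 1 = τ (b + 2) := by
    rintro τ τ' ⟨hb, hF, hsum⟩ ⟨_, ⟨hpos, rfl⟩, τ₁, h₁, _, rfl, rfl⟩
    obtain ⟨hb₁, hy⟩ := (h' _).1 _ h₁
    have e₁ : τ₁ (b + 1) = τ (b + 1) := by rw [hb₁ _ (by omega)]; simp
    have e₂ : τ₁ (b + 2) = τ (b + 2) - 1 := by rw [hb₁ _ (by omega)]; simp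
    have e₃ : ∀ i ≤ b, τ₁ i = τ i := fun i hi => by
      rw [hb₁ _ (by omega), Function.update_of_ne (by omega)]
    rw [comp_congr_below hrs (σ := σ) fun i hi => by
      rw [Function.update_of_ne (by omega), hb i hi]] at hy
    simp only [ne_eq, Function.update_of_ne, Nat.reduceEqDiff, Nat.add_left_cancel_iff,
      not_false_eq_true, hF, show b ≠ b + 2 by omega] at hy
    refine ⟨⟨fun i hi => ?_, ?_, ?_⟩, ?_⟩
    · rw [Function.update_of_ne (by omega), Function.update_of_ne hi.ne, e₃ i hi.le, hb i hi]
    · simpa [e₁, F] using hy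
    · simp [e₁, e₂]
      omega
    · simp [e₂]
      omega
  constructor
  · rintro σ' ⟨σ₁, h₁, _, rfl, _, rfl, σ₂, h₂, h0, rfl⟩
    have : Inv σ' := by
      clear h0
      induction h₂ with
      | refl => exact hinit _ h₁
      | tail _ h₂ ih => exact (hstep _ _ ih h₂).1
    refine ⟨this.1, this.2.1.trans ?_⟩
    rw [show σ' (b + 1) = σ (r 0) by have := this.2.2; omega]
  · obtain ⟨σ₁, h₁⟩ := (h σ).2
    have hreach : ∀ k τ, Inv τ → τ (b + 2) = k → ∃ τ', Relation.ReflTransGen B τ τ' ∧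
        τ' (b + 2) = 0 := by
      intro k
      induction k with
      | zero => exact fun τ _ h0 => ⟨τ, .refl, h0⟩
      | succ k ih =>
        intro τ hI hk
        obtain ⟨τ₁, hτ₁⟩ := (h' (Function.update τ (b + 2) (τ (b + 2) - 1))).2
        have hs : B τ _ := ⟨_, ⟨by omega, rfl⟩, τ₁, hτ₁, _, rfl, rfl⟩
        obtain ⟨hI', hk'⟩ := hstep _ _ hI hs
        obtain ⟨τ', hτ', h0⟩ := ih _ hI' (by omega)
        exact ⟨τ', .head hs hτ', h0⟩
    obtain ⟨σ₂, h₂, h0⟩ := hreach _ _ (hinit σ₁ h₁) rfl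
    exact ⟨σ₂, σ₁, h₁, _, rfl, _, rfl, σ₂, h₂, h0, rfl⟩

theorem regComputable_of_primrec' {n : ℕ} {f : List.Vector ℕ n → ℕ} (hf : Nat.Primrec' f) :
    RegComputable (f : List.Vector ℕ n →. ℕ) := by
  induction hf with
  | zero =>
    refine fun r b hr => ⟨_, realizable_clear b, fun σ => ⟨?_, fun y _ => ⟨_, rfl⟩⟩⟩
    rintro _ rfl
    exact ⟨fun i hi => by simp [hi.ne], by simp⟩
  | succ =>
    refine fun r b hr => ⟨_, (realizable_copy (r 0) b).comp (realizable_inc b),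
      fun σ => ⟨?_, fun y _ => ⟨_, _, rfl, rfl⟩⟩⟩
    rintro _ ⟨_, rfl, rfl⟩
    exact ⟨fun i hi => by simp [hi.ne], by simp⟩
  | get j =>
    refine fun r b hr => ⟨_, realizable_copy (r j) b, fun σ => ⟨?_, fun y _ => ⟨_, rfl⟩⟩⟩
    rintro _ rfl
    exact ⟨fun i hi => by simp [hi.ne], by simp⟩
  | comp g _ _ hf hg =>
    exact (hf.comp hg).of_eq fun v => by
      simp only [PFun.coe_val, Vector.mOfFn_part_some]
      exact Part.bind_some _ _
  | prec _ _ hf hg => exact hf.prec hg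

theorem regComputable_of_partrec' {n : ℕ} {f : List.Vector ℕ n →. ℕ} (hf : Nat.Partrec' f) :
    RegComputable f := by
  induction hf with
  | prim hf => exact regComputable_of_primrec' hf
  | comp g _ _ hf hg => exact hf.comp hg
  | rfind _ hf => exact hf.rfind


/-! ### Recurrence computes existence of infinite branches -/

theorem realizable_guess (i : ℕ) :
    Realizable fun σ σ' => ∃ x, σ' = Function.update σ i x := by
  have h := (realizable_clear i).comp (realizable_inc i).star
  convert h using 3 with σ σ'
  constructor
  · rintro ⟨x, rfl⟩
    refine ⟨_, rfl, ?_⟩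
    induction x with
    | zero => exact .refl
    | succ x ih => exact ih.tail (by simp)
  · rintro ⟨_, rfl, h⟩
    induction h with
    | refl => exact ⟨0, rfl⟩
    | tail _ h ih =>
      obtain ⟨x, rfl⟩ := ih
      exact ⟨_, by rw [h, Function.update_idem]⟩

/-- A realizable relation that replaces the register `0` by a value of `G` at this register and a
guessed number. -/
theorem RegComputable.exists_realizable_step {G : List.Vector ℕ 2 →. ℕ} (hG : RegComputable G) :
    ∃ D, Realizable D ∧ ∀ σ y, (∃ σ', D σ σ' ∧ σ' 0 = y) ↔ ∃ x, y ∈ G (σ 0 ::ᵥ x ::ᵥ .nil) := by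
  obtain ⟨S, hS, h⟩ := hG ![0, 1] 2 (by simp [Fin.forall_fin_two])
  have hv : ∀ σ : ℕ → ℕ, List.Vector.ofFn (σ ∘ ![0, 1]) = σ 0 ::ᵥ σ 1 ::ᵥ .nil := fun _ => rfl
  simp only [Implements, hv] at h
  refine ⟨_, (realizable_guess 1).comp (hS.comp (realizable_copy 2 0)), fun σ y => ⟨?_, ?_⟩⟩
  · rintro ⟨_, ⟨_, ⟨x, rfl⟩, σ₂, h₂, rfl⟩, rfl⟩
    exact ⟨x, by simpa using ((h _).1 _ h₂).2⟩
  · rintro ⟨x, hy⟩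
    have hy' : y ∈ G (Function.update σ 1 x 0 ::ᵥ Function.update σ 1 x 1 ::ᵥ .nil) := by
      simpa using hy
    obtain ⟨σ₂, h₂⟩ := (h _).2 y hy'
    exact ⟨_, ⟨_, ⟨x, rfl⟩, σ₂, h₂, rfl⟩, by
      simpa using Part.mem_unique ((h _).1 _ h₂).2 hy'⟩

theorem chainTape_eq_regTape {K : ℕ} (hK : 1 ≤ K) (c : ℕ) :
    chainTape (2 ^ K) 1 c = regTape K (Function.update 0 0 c) := by
  rw [eq_regTape_iff]
  refine ⟨rfl, fun j k => ?_⟩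
  rcases k with _ | k
  · by_cases h : j < c <;> simp [chainTape, h]
    omega
  · by_cases h : j < c <;> simp [chainTape, h, Nat.testBit_succ]

theorem exists_chainMachine_recurring_iff {G : List.Vector ℕ 2 →. ℕ} (hG : RegComputable G) :
    ∃ N base q₀ home one qr E, ∀ c, NTM.WF (chainMachine N base q₀ home one E c) ∧
      qr < NTM.numStates (chainMachine N base q₀ home one E c) ∧
      (RecurringFrom (chainMachine N base q₀ home one E c) qr
        (startConfig (chainMachine N base q₀ home one E c) []) ↔
        ∃ s : ℕ → ℕ, s 0 = c ∧ ∀ i, ∃ x, s (i + 1) ∈ G (s i ::ᵥ x ::ᵥ .nil)) := by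
  obtain ⟨D, hD, hDG⟩ := hG.exists_realizable_step
  obtain ⟨K, ⟨P, hP⟩, hK⟩ := (hD.and (Filter.eventually_ge_atTop 1)).exists
  have h2 : 2 ≤ 2 ^ K := le_self_pow₀ (by norm_num) (by omega)
  obtain ⟨base, q₀, qr, E, h⟩ := exists_chainMachine (N := 2 ^ K + 1) (home := 2 ^ K) (one := 1)
    (by omega) (by omega) (by omega) (TapeProg.rewind K) P
  refine ⟨_, base, q₀, _, _, qr, E, fun c => ⟨(h c).1, (h c).2.1, (h c).2.2.trans ?_⟩⟩
  have hbelow : SymbolsBelow (2 ^ K + 1) (regTape K (Function.update 0 0 c), c) := fun j => by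
    cases j with
    | zero => exact Nat.lt_succ_self _
    | succ j => exact (regTape_succ_lt K _ j).trans (Nat.lt_succ_self _)
  rw [chainTape_eq_regTape hK, recur_progStep_iff hbelow]
  constructor
  · rintro ⟨u, ⟨_, hu0, rfl⟩, hu⟩
    rw [TapeProg.rewind_regTape_sem] at hu0
    obtain ⟨σ, h0, hσ⟩ := exists_seq_of_forall_exists
      (P := fun i σ => u i = (regTape K σ, 0)) (r := D) hu0 fun i σ hσ => by
        have := hu i
        rwa [hσ, hP] at this
    exact ⟨fun i => σ i 0, by simp [h0], fun i => (hDG _ _).1 ⟨_, (hσ i).2, rfl⟩⟩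
  · rintro ⟨s, rfl, hs⟩
    obtain ⟨σ, h0, hσ⟩ := exists_seq_of_forall_exists (a := Function.update 0 0 (s 0))
      (P := fun i σ => σ 0 = s i) (r := D) (by simp) fun i σ hσ => (hDG σ _).2 (hσ ▸ hs i)
    refine ⟨fun i => (regTape K (σ i), 0), ⟨_, ?_, rfl⟩, fun i => (hP _ _).2 ⟨_, (hσ i).2, rfl⟩⟩
    rw [TapeProg.rewind_regTape_sem]
    exact congrArg (fun σ => (regTape K σ, 0)) h0

/-- The extension of a code of a pair `(n, L)` by an element `x`, provided that `R n L` fails. -/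
def extendBranch (R : ℕ → List ℕ → Bool) (v : List.Vector ℕ 2) : Part ℕ :=
  let p : ℕ × List ℕ := (Encodable.decode v.head).getD default
  bif R p.1 p.2 then Part.none else Part.some (Encodable.encode (p.1, p.2 ++ [v.tail.head]))

theorem regComputable_extendBranch {R : ℕ → List ℕ → Bool} (hR : Computable₂ R) :
    RegComputable (extendBranch R) := by
  refine regComputable_of_partrec' (Nat.Partrec'.of_part ?_)
  have hp : Computable fun v : List.Vector ℕ 2 =>
      ((Encodable.decode v.head).getD default : ℕ × List ℕ) :=
    (Primrec.option_getD.comp (Primrec.decode.comp Primrec.vector_head)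
      (Primrec.const default)).to_comp
  have hx : Computable fun v : List.Vector ℕ 2 => v.tail.head :=
    (Primrec.vector_head.comp Primrec.vector_tail).to_comp
  refine Partrec.cond (hR.comp (Computable.fst.comp hp) (Computable.snd.comp hp)) Partrec.none
    (Computable.partrec ?_)
  exact Computable.encode.comp ((Computable.fst.comp hp).pair
    (Computable.list_append.comp (Computable.snd.comp hp)
      (Primrec.list_cons.to_comp.comp hx (Computable.const []))))

theorem mem_extendBranch {R : ℕ → List ℕ → Bool} {n x y : ℕ} {L : List ℕ} :
    y ∈ extendBranch R (Encodable.encode (n, L) ::ᵥ x ::ᵥ .nil) ↔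
      R n L = false ∧ y = Encodable.encode (n, L ++ [x]) := by
  simp only [extendBranch, List.Vector.head_cons, List.Vector.tail_cons, Encodable.encodek,
    Option.getD_some]
  cases R n L <;> simp

theorem exists_branch_iff (R : ℕ → List ℕ → Bool) (n : ℕ) :
    (∃ s : ℕ → ℕ, s 0 = Encodable.encode (n, ([] : List ℕ)) ∧
      ∀ i, ∃ x, s (i + 1) ∈ extendBranch R (s i ::ᵥ x ::ᵥ .nil)) ↔
      ∃ f : ℕ → ℕ, ∀ k, R n ((List.range k).map f) = false := by
  constructor
  · rintro ⟨s, h0, hs⟩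
    choose f hf using hs
    have key : ∀ k, s k = Encodable.encode (n, (List.range k).map f) := fun k => by
      induction k with
      | zero => simpa using h0
      | succ k ih =>
        have := hf k
        rw [ih, mem_extendBranch] at this
        simpa [List.range_succ] using this.2
    refine ⟨f, fun k => ?_⟩
    have := hf k
    rw [key, mem_extendBranch] at this
    exact this.1
  · rintro ⟨f, hf⟩
    refine ⟨fun k => Encodable.encode (n, (List.range k).map f), rfl, fun k => ⟨f k, ?_⟩⟩
    rw [mem_extendBranch]
    exact ⟨hf k, by simp [List.range_succ]⟩

theorem primrec_chainMachine (N base q₀ home one : ℕ) (E : List ((ℕ × ℕ) × (ℕ × ℕ × Bool))) :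
    Primrec (chainMachine N base q₀ home one E) := by
  have hadd : Primrec fun c => base + c := Primrec.nat_add.comp (Primrec.const base) Primrec.id
  refine (Primrec.succ.comp hadd).pair ((Primrec.const N).pair
    (Primrec.list_cons.comp (Primrec.const _) (Primrec.list_cons.comp ?_
      (Primrec.list_append.comp ?_ (Primrec.const E)))))
  · exact (hadd.pair (Primrec.const N)).pair (Primrec.const _)
  · have h := hadd.comp (Primrec.snd (α := ℕ) (β := ℕ))
    exact Primrec.list_map Primrec.list_range <| Primrec.to₂ <| (h.pair (Primrec.const N)).pair
      ((Primrec.succ.comp h).pair ((Primrec.const one).pair (Primrec.const true)))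


/-! ### Upper and lower bound -/

/-- Absence of infinite paths of a primitive recursive relation is a `Π¹₁` property. -/
theorem pi11_of_primrec {α β : Type} [Primcodable α] [Primcodable β] [Inhabited β]
    {ok : α → Prop} {init : α → β → Prop} {step : α → β × β → Prop} (hok : PrimrecPred ok)
    (hinit : PrimrecRel init) (hstep : PrimrecRel step) :
    Pi11 fun a => ok a ∧ ¬ ∃ s : ℕ → β, init a (s 0) ∧ ∀ i, step a (s i, s (i + 1)) := by
  classical
  let dec : ℕ → β := fun n => (Encodable.decode n).getD default
  have hdec : Primrec dec := Primrec.option_getD.comp Primrec.decode (Primrec.const default)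
  have hlen : Primrec fun x : α × List ℕ => x.2.length := Primrec.list_length.comp Primrec.snd
  have hget : ∀ {i : α × List ℕ → ℕ}, Primrec i → Primrec fun x : α × List ℕ => dec (x.2.getD (i x) 0) :=
    fun hi => hdec.comp ((Primrec.list_getD 0).comp Primrec.snd hi)
  have hR : PrimrecRel fun (a : α) (L : List ℕ) => ok a ∧ 2 ≤ L.length ∧
      ¬ (init a (dec (L.getD 0 0)) ∧
        step a (dec (L.getD (L.length - 2) 0), dec (L.getD (L.length - 1) 0))) :=
    (hok.comp Primrec.fst).and <| (Primrec.nat_le.comp (Primrec.const 2) hlen).and <|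
      ((hinit.comp Primrec.fst (hget (Primrec.const 0))).and <| hstep.comp Primrec.fst <|
        (hget (Primrec.nat_sub.comp hlen (Primrec.const 2))).pair
          (hget (Primrec.nat_sub.comp hlen (Primrec.const 1)))).not
  refine ⟨_, hR.decide.to_comp, fun a => ?_⟩
  simp only [decide_eq_true_iff, List.length_map, List.length_range]
  constructor
  · rintro ⟨ha, h⟩ f
    by_contra! hf
    refine h ⟨fun i => dec (f i), ?_, fun i => ?_⟩
    · simpa [List.getD_eq_getElem] using (hf 2 ha le_rfl).1
    · simpa [List.getD_eq_getElem] using (hf (i + 2) ha (by omega)).2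
  · intro h
    refine ⟨(h 0).choose_spec.1, ?_⟩
    rintro ⟨s, h0, hs⟩
    obtain ⟨k, -, hk, hne⟩ := h fun i => Encodable.encode (s i)
    obtain ⟨i, rfl⟩ := Nat.exists_eq_add_of_le' hk
    apply hne
    constructor
    · simpa [List.getD_eq_getElem, dec] using h0
    · simpa [List.getD_eq_getElem, dec] using hs i

theorem NTM.primrecPred_wf : PrimrecPred NTM.WF := by
  have hst : Primrec NTM.numStates := Primrec.fst
  have hbl : Primrec NTM.blank := Primrec.fst.comp Primrec.snd
  have htb : Primrec NTM.table := Primrec.snd.comp Primrec.snd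
  have hentry : PrimrecRel fun (e : (ℕ × ℕ) × (ℕ × ℕ × Bool)) (M : NTM) =>
      e.1.1 < NTM.numStates M ∧ e.1.2 ≤ NTM.blank M ∧ e.2.1 < NTM.numStates M ∧
        e.2.2.1 < NTM.blank M := by
    have hst' := hst.comp (Primrec.snd (α := (ℕ × ℕ) × (ℕ × ℕ × Bool)) (β := NTM))
    have hbl' := hbl.comp (Primrec.snd (α := (ℕ × ℕ) × (ℕ × ℕ × Bool)) (β := NTM))
    have he := Primrec.fst (α := (ℕ × ℕ) × (ℕ × ℕ × Bool)) (β := NTM)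
    have h1 := Primrec.fst.comp he
    have h2 := Primrec.snd.comp he
    exact (Primrec.nat_lt.comp (Primrec.fst.comp h1) hst').and <|
      (Primrec.nat_le.comp (Primrec.snd.comp h1) hbl').and <|
      (Primrec.nat_lt.comp (Primrec.fst.comp h2) hst').and <|
      Primrec.nat_lt.comp (Primrec.fst.comp (Primrec.snd.comp h2)) hbl'
  exact (Primrec.nat_le.comp (Primrec.const 1) hst).and <|
    (Primrec.nat_le.comp (Primrec.const 2) hbl).and <|
    hentry.forall_mem_list.comp htb Primrec.id

theorem NTM.next_iff_exists_mem {M : NTM} {ρ ρ' : Config} : NTM.Next M ρ ρ' ↔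
    ∃ e ∈ NTM.table M, e.1 = (ρ.2.2, ρ.1.getD ρ.2.1 0) ∧ (e.2.2.2 = true ∨ 1 ≤ ρ.2.1) ∧
      ρ' = (ρ.1.set ρ.2.1 e.2.2.1 ++ [NTM.blank M],
        if e.2.2.2 = true then ρ.2.1 + 1 else ρ.2.1 - 1, e.2.1) := by
  constructor
  · rintro ⟨q', b, d, he, hd, rfl⟩
    exact ⟨_, he, rfl, hd, rfl⟩
  · rintro ⟨⟨_, q', b, d⟩, he, rfl, hd, rfl⟩
    exact ⟨q', b, d, he, hd, rfl⟩

/-- A table entry, a blank symbol and two configurations. -/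
abbrev StepData : Type := ((ℕ × ℕ) × (ℕ × ℕ × Bool)) × (ℕ × Config × Config)

theorem NTM.primrecRel_next :
    PrimrecRel fun (M : NTM) (x : Config × Config) => NTM.Next M x.1 x.2 := by
  have he : Primrec fun x : StepData => x.1 := Primrec.fst
  have hact : Primrec fun x : StepData => x.1.2.2 := Primrec.snd.comp (Primrec.snd.comp he)
  have hblank : Primrec fun x : StepData => x.2.1 := Primrec.fst.comp Primrec.snd
  have hconfs : Primrec fun x : StepData => x.2.2 := Primrec.snd.comp Primrec.snd
  have htape : Primrec fun x : StepData => x.2.2.1.1 := Primrec.fst.comp (Primrec.fst.comp hconfs)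
  have hctrl : Primrec fun x : StepData => x.2.2.1.2 := Primrec.snd.comp (Primrec.fst.comp hconfs)
  have hpos : Primrec fun x : StepData => x.2.2.1.2.1 := Primrec.fst.comp hctrl
  have hdir : PrimrecPred fun x : StepData => x.1.2.2.2 = true :=
    Primrec.eq.comp (Primrec.snd.comp hact) (Primrec.const true)
  have hread : PrimrecPred fun x : StepData => x.1.1 = (x.2.2.1.2.2, x.2.2.1.1.getD x.2.2.1.2.1 0) :=
    Primrec.eq.comp (Primrec.fst.comp he)
      ((Primrec.snd.comp hctrl).pair ((Primrec.list_getD 0).comp htape hpos))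
  have hmove : PrimrecPred fun x : StepData => x.1.2.2.2 = true ∨ 1 ≤ x.2.2.1.2.1 :=
    hdir.or (Primrec.nat_le.comp (Primrec.const 1) hpos)
  have hset := Primrec.list_set.comp htape (hpos.pair (Primrec.fst.comp hact))
  have hsingle : Primrec fun x : StepData => [x.2.1] :=
    Primrec.list_cons.comp hblank (Primrec.const [])
  have htape' : Primrec fun x : StepData => x.2.2.1.1.set x.2.2.1.2.1 x.1.2.2.1 ++ [x.2.1] :=
    Primrec.list_append.comp hset hsingle
  have hpos' : Primrec fun x : StepData =>
      if x.1.2.2.2 = true then x.2.2.1.2.1 + 1 else x.2.2.1.2.1 - 1 :=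
    Primrec.ite hdir (Primrec.succ.comp hpos) (Primrec.pred.comp hpos)
  have hnext : PrimrecPred fun x : StepData => x.2.2.2 = (x.2.2.1.1.set x.2.2.1.2.1 x.1.2.2.1 ++ [x.2.1],
      if x.1.2.2.2 = true then x.2.2.1.2.1 + 1 else x.2.2.1.2.1 - 1, x.1.2.1) :=
    Primrec.eq.comp (Primrec.snd.comp hconfs)
      (htape'.pair (hpos'.pair (Primrec.fst.comp (Primrec.snd.comp he))))
  have hentry : PrimrecRel fun (e : (ℕ × ℕ) × (ℕ × ℕ × Bool)) (y : ℕ × Config × Config) =>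
      e.1 = (y.2.1.2.2, y.2.1.1.getD y.2.1.2.1 0) ∧ (e.2.2.2 = true ∨ 1 ≤ y.2.1.2.1) ∧
      y.2.2 = (y.2.1.1.set y.2.1.2.1 e.2.2.1 ++ [y.1],
        if e.2.2.2 = true then y.2.1.2.1 + 1 else y.2.1.2.1 - 1, e.2.1) :=
    hread.and (hmove.and hnext)
  have hbl : Primrec NTM.blank := Primrec.fst.comp Primrec.snd
  have htb : Primrec NTM.table := Primrec.snd.comp Primrec.snd
  exact (hentry.exists_mem_list.comp (htb.comp Primrec.fst)
    ((hbl.comp Primrec.fst).pair Primrec.snd)).of_eq fun _ => NTM.next_iff_exists_mem.symm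

theorem pi11_nonRecurring_empty_word : Pi11 fun p : NTM × ℕ =>
    NTM.WF p.1 ∧ p.2 < NTM.numStates p.1 ∧ NonRecurringFrom p.1 p.2 (startConfig p.1 []) := by
  have hok : PrimrecPred fun p : NTM × ℕ => NTM.WF p.1 ∧ p.2 < NTM.numStates p.1 :=
    (NTM.primrecPred_wf.comp Primrec.fst).and
      (Primrec.nat_lt.comp Primrec.snd (Primrec.fst.comp Primrec.fst))
  have hinit : PrimrecRel fun (p : NTM × ℕ) (x : Config × ℕ) => x.1 = startConfig p.1 [] :=
    Primrec.eq.comp (Primrec.fst.comp Primrec.snd) <| Primrec.pair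
      (Primrec.list_cons.comp (Primrec.fst.comp (Primrec.snd.comp (Primrec.fst.comp Primrec.fst)))
        (Primrec.const [])) (Primrec.const (0, 0))
  have hstep : PrimrecRel fun (p : NTM × ℕ) (x : (Config × ℕ) × (Config × ℕ)) =>
      NTM.Next p.1 x.1.1 x.2.1 ∧ (x.1.2 = 0 ∧ x.1.1.2.2 = p.2 ∨ x.1.2 = x.2.2 + 1) := by
    have hp := Primrec.fst (α := NTM × ℕ) (β := (Config × ℕ) × (Config × ℕ))
    have hx := Primrec.snd (α := NTM × ℕ) (β := (Config × ℕ) × (Config × ℕ))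
    have h1 := Primrec.fst.comp hx
    have h2 := Primrec.snd.comp hx
    exact (NTM.primrecRel_next.comp (Primrec.fst.comp hp)
        ((Primrec.fst.comp h1).pair (Primrec.fst.comp h2))).and <|
      ((Primrec.eq.comp (Primrec.snd.comp h1) (Primrec.const 0)).and
        (Primrec.eq.comp (Primrec.snd.comp (Primrec.snd.comp (Primrec.fst.comp h1)))
          (Primrec.snd.comp hp))).or
      (Primrec.eq.comp (Primrec.snd.comp h1) (Primrec.succ.comp (Primrec.snd.comp h2)))
  convert pi11_of_primrec hok hinit hstep using 2 with p
  rw [and_assoc]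
  exact and_congr_right' <| and_congr_right' <| not_congr <|
    recur_iff_countdown (P := fun ρ : Config => ρ.2.2 = p.2)

theorem pi11Hard_nonRecurring_empty_word : Pi11Hard fun p : NTM × ℕ =>
    NTM.WF p.1 ∧ p.2 < NTM.numStates p.1 ∧ NonRecurringFrom p.1 p.2 (startConfig p.1 []) := by
  rintro q ⟨R, hR, hq⟩
  obtain ⟨N, base, q₀, home, one, qr, E, h⟩ :=
    exists_chainMachine_recurring_iff (regComputable_extendBranch hR)
  have hcode : Primrec fun n : ℕ => Encodable.encode (n, ([] : List ℕ)) :=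
    Primrec.encode.comp (Primrec.id.pair (Primrec.const []))
  refine ⟨_, (((primrec_chainMachine N base q₀ home one E).comp hcode).pair
    (Primrec.const qr)).to_comp, fun n => ?_⟩
  obtain ⟨hwf, hqr, hrec⟩ := h (Encodable.encode (n, ([] : List ℕ)))
  rw [exists_branch_iff] at hrec
  rw [hq]
  simp only [hwf, hqr, true_and, NonRecurringFrom, hrec]
  push Not
  simp

/-- Deciding, given a non-deterministic Turing machine `M` and a state `q_r`
of `M`, whether `M` is non-recurring through `q_r` on the empty word `ε` (every run of `M` on
`ε` features `q_r` only finitely many times) is `Π¹₁`-complete. -/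
theorem nonRecurring_empty_word_Pi11Complete :
    Pi11Complete (fun p : NTM × ℕ =>
      NTM.WF p.1 ∧ p.2 < NTM.numStates p.1 ∧
      NonRecurringFrom p.1 p.2 (startConfig p.1 [])) :=
  ⟨pi11_nonRecurring_empty_word, pi11Hard_nonRecurring_empty_word⟩

end ChaseTermination
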